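/- arXiv:1306.2410 — 2 statements merged into one kernel-verified Lean document; each statement's English description precedes it below -/
import Mathlib

section
/- Let X = (X₁,…,X_m) be a centered N-dimensional Gaussian random vector with block covariance matrix T = (T_{ij}) and let P = diag(p₁T₁₁,…,p_mT_mm) for real exponents p₁,…,p_m. If T ≤ P (i.e. P − T is positive semidefinite), then for every choice of nonnegative measurable functions fᵢ : ℝ^{nᵢ} → [0,∞), 1 ≤ i ≤ m, one has E[∏_{i=1}^m fᵢ(Xᵢ)] ≤ ∏_{i=1}^m (E[fᵢ(Xᵢ)^{pᵢ}])^{1/pᵢ}. -/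
open MeasureTheory ProbabilityTheory Matrix
open scoped ENNReal

/-- The standard Gaussian measure on `ι → ℝ`. -/
noncomputable def stdGaussian (ι : Type*) [Fintype ι] : Measure (ι → ℝ) :=
  Measure.pi fun _ => gaussianReal 0 1

/-- The `p`-mean `(∫ f^p)^(1/p)` of a nonnegative function, read as
`exp (∫ log f)` when `p = 0`. -/
noncomputable def pMeanE {α : Type*} [MeasurableSpace α] (μ : Measure α)
    (f : α → ℝ≥0∞) (p : ℝ) : ℝ≥0∞ :=
  if p = 0 then ENNReal.ofReal (Real.exp (∫ x, Real.log (f x).toReal ∂μ))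
  else (∫⁻ x, f x ^ p ∂μ) ^ (1 / p)

section PartA
open MeasureTheory ProbabilityTheory Matrix
open scoped ENNReal

theorem gh_log_le {r : ℝ} (hr : -1 < r) : Real.log (1 + r) ≤ r - r^2/2 + |r|^3/3 := by
  have key : ∀ r : ℝ, -1 < r → Real.log (1 + r) ≤ r - r^2/2 + r^3/3 := by
    intro r hr
    let F : ℝ → ℝ := fun r => r - r^2/2 + r^3/3 - Real.log (1 + r)
    have hd : ∀ x, -1 < x → HasDerivAt F (x^3/(1+x)) x := by
      intro x hx
      have h1 : HasDerivAt (fun x : ℝ => Real.log (1 + x)) (1/(1+x)) x :=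
        ((hasDerivAt_id x).const_add 1).log (by simp; linarith)
      have h2 : HasDerivAt (fun x : ℝ => x - x^2/2 + x^3/3) (1 - x + x^2) x := by
        have := (((hasDerivAt_id x).sub ((hasDerivAt_pow 2 x).div_const 2)).add
          ((hasDerivAt_pow 3 x).div_const 3))
        convert! this using 1
        simp
      convert! h2.sub h1 using 1
      have : (1:ℝ) + x ≠ 0 := by linarith
      field_simp; ring
    have hF0 : F 0 = 0 := by simp [F]
    have : F 0 ≤ F r := by
      rcases le_total 0 r with h | h
      · have hm : MonotoneOn F (Set.Icc 0 r) := by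
          apply monotoneOn_of_deriv_nonneg (convex_Icc 0 r)
          · intro x hx; exact (hd x (by linarith [hx.1])).continuousAt.continuousWithinAt
          · intro x hx; rw [interior_Icc] at hx
            exact (hd x (by linarith [hx.1])).differentiableAt.differentiableWithinAt
          · intro x hx; rw [interior_Icc] at hx
            rw [(hd x (by linarith [hx.1])).deriv]
            have := hx.1
            positivity
        exact hm ⟨le_rfl, h⟩ ⟨h, le_rfl⟩ h
      · have hm : AntitoneOn F (Set.Icc r 0) := by
          apply antitoneOn_of_deriv_nonpos (convex_Icc r 0)
          · intro x hx; exact (hd x (by linarith [hx.1])).continuousAt.continuousWithinAt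
          · intro x hx; rw [interior_Icc] at hx
            exact (hd x (by linarith [hx.1])).differentiableAt.differentiableWithinAt
          · intro x hx; rw [interior_Icc] at hx
            rw [(hd x (by linarith [hx.1])).deriv]
            apply div_nonpos_of_nonpos_of_nonneg _ (by linarith [hx.1])
            have := hx.2
            nlinarith [sq_nonneg x, mul_nonneg (sq_nonneg x) (neg_nonneg.2 hx.2.le)]
        exact hm ⟨le_rfl, h⟩ ⟨h, le_rfl⟩ h
    rw [hF0] at this
    simp only [F] at this
    linarith
  refine (key r hr).trans ?_
  have : r^3 ≤ |r|^3 := by rw [← abs_pow]; exact le_abs_self _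
  linarith

theorem gh_exp_le (x : ℝ) : Real.exp x ≤ 1 + x + x^2/2 + |x|^3 * Real.exp |x| := by
  have := Complex.norm_exp_sub_sum_le_norm_mul_exp (x : ℂ) 3
  simp only [Finset.sum_range_succ, Finset.sum_range_zero] at this
  have h2 : Complex.exp x - (0 + (x:ℂ)^0 / (Nat.factorial 0 : ℂ) + (x:ℂ)^1 / (Nat.factorial 1 : ℂ) + (x:ℂ)^2 / (Nat.factorial 2 : ℂ))
     = ((Real.exp x - (1 + x + x^2/2) : ℝ) : ℂ) := by
    push_cast; simp [Nat.factorial]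
  rw [h2, Complex.norm_real, Complex.norm_real, Real.norm_eq_abs, Real.norm_eq_abs] at this
  linarith [le_abs_self (Real.exp x - (1 + x + x^2/2))]

theorem gh_prod_le (m : ℕ) (R : ℝ) (hR : 0 ≤ R) : ∃ C : ℝ, 0 ≤ C ∧ ∀ (q r : Fin m → ℝ),
    (∀ i, 0 < q i) → (∀ i, q i ≤ 1) → (∀ i, -1 < r i) → (∀ i, |r i| ≤ R) →
    ∏ i, (1 + r i) ^ (q i) ≤ 1 + ∑ i, q i * r i
      + ((∑ i, q i * r i)^2 - ∑ i, q i * (r i)^2) / 2 + C * (∑ i, |r i|)^3 := by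
  set D : ℝ := m * R with hD
  have hD0 : 0 ≤ D := by positivity
  set K : ℝ := 1 + D + D^2 with hK
  have hK0 : 1 ≤ K := by nlinarith
  refine ⟨1 + (2 * K + K^2 * D)/2 + K^3 * Real.exp (K * D), by positivity, ?_⟩
  intro q r hq0 hq1 hr1 hrR
  set ρ := ∑ i, |r i| with hρ
  have hρ0 : 0 ≤ ρ := Finset.sum_nonneg fun i _ => abs_nonneg _
  have hρD : ρ ≤ D := by
    calc ρ ≤ ∑ i : Fin m, R := Finset.sum_le_sum fun i _ => hrR i
      _ = D := by simp [hD]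
  have hle : ∀ i, |r i| ≤ ρ := fun i =>
    Finset.single_le_sum (f := fun i => |r i|) (fun i _ => abs_nonneg _) (Finset.mem_univ i)
  set s := ∑ i, q i * r i with hs
  set v := ∑ i, q i * (r i)^2 with hv
  set κ := ∑ i, q i * (|r i|^3/3) with hκ
  have hsρ : |s| ≤ ρ := by
    refine (Finset.abs_sum_le_sum_abs _ _).trans (Finset.sum_le_sum fun i _ => ?_)
    rw [abs_mul, abs_of_pos (hq0 i)]
    exact mul_le_of_le_one_left (abs_nonneg _) (hq1 i)
  have hv0 : 0 ≤ v := Finset.sum_nonneg fun i _ => mul_nonneg (hq0 i).le (sq_nonneg _)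
  have hvρ : v ≤ ρ^2 := by
    calc v ≤ ∑ i, |r i| * ρ := by
          refine Finset.sum_le_sum fun i _ => ?_
          rw [← sq_abs]
          calc q i * |r i|^2 ≤ |r i|^2 := mul_le_of_le_one_left (by positivity) (hq1 i)
            _ = |r i| * |r i| := by ring
            _ ≤ _ := mul_le_mul_of_nonneg_left (hle i) (abs_nonneg _)
      _ = ρ^2 := by rw [← Finset.sum_mul]; ring
  have hκ0 : 0 ≤ κ := Finset.sum_nonneg fun i _ => mul_nonneg (hq0 i).le (by positivity)
  have hκρ : κ ≤ ρ^3 := by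
    calc κ ≤ ∑ i, |r i| * ρ^2 := by
          refine Finset.sum_le_sum fun i _ => ?_
          calc q i * (|r i|^3/3) ≤ |r i|^3/3 := mul_le_of_le_one_left (by positivity) (hq1 i)
            _ ≤ |r i|^3 := by linarith [pow_nonneg (abs_nonneg (r i)) 3]
            _ = |r i| * |r i|^2 := by ring
            _ ≤ _ := mul_le_mul_of_nonneg_left (pow_le_pow_left₀ (abs_nonneg _) (hle i) 2) (abs_nonneg _)
      _ = ρ^3 := by rw [← Finset.sum_mul]; ring
  set e := -v/2 + κ with he
  have heρ : |e| ≤ ρ^2 * K := by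
    have h3 : ρ^3 ≤ ρ^2 * D := by rw [pow_succ]; exact mul_le_mul_of_nonneg_left hρD (by positivity)
    have : ρ^2 * (1 + D) ≤ ρ^2 * K := mul_le_mul_of_nonneg_left (by nlinarith) (by positivity)
    rw [abs_le]; constructor <;> nlinarith
  have huρ : |s + e| ≤ K * ρ := by
    have h2 : ρ^2 ≤ D * ρ := by nlinarith
    have h3 : ρ^3 ≤ D^2 * ρ := by
      calc ρ^3 = ρ^2 * ρ := by ring
        _ ≤ D^2 * ρ := mul_le_mul_of_nonneg_right (pow_le_pow_left₀ hρ0 hρD 2) hρ0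
    have : |e| ≤ ρ^2 + ρ^3 := by
      rw [abs_le]; constructor <;> nlinarith [pow_nonneg hρ0 2, pow_nonneg hρ0 3]
    calc |s + e| ≤ |s| + |e| := abs_add_le _ _
      _ ≤ ρ + (ρ^2 + ρ^3) := add_le_add hsρ this
      _ ≤ K * ρ := by rw [hK]; nlinarith
  have h1 : ∏ i, (1 + r i) ^ (q i) ≤ Real.exp (s + e) := by
    have : ∏ i, (1 + r i) ^ (q i) = Real.exp (∑ i, q i * Real.log (1 + r i)) := by
      rw [Real.exp_sum]
      refine Finset.prod_congr rfl fun i _ => ?_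
      rw [Real.rpow_def_of_pos (by linarith [hr1 i]), mul_comm]
    rw [this, Real.exp_le_exp]
    calc _ ≤ ∑ i, q i * (r i - (r i)^2/2 + |r i|^3/3) :=
          Finset.sum_le_sum fun i _ => mul_le_mul_of_nonneg_left (gh_log_le (hr1 i)) (hq0 i).le
      _ = s + e := by
          rw [hs, he, hv, hκ, neg_div, Finset.sum_div, ← Finset.sum_neg_distrib, ← Finset.sum_add_distrib, ← Finset.sum_add_distrib]
          exact Finset.sum_congr rfl fun i _ => by ring
  refine h1.trans ((gh_exp_le _).trans ?_)
  have hA : |s + e|^3 * Real.exp |s + e| ≤ K^3 * Real.exp (K * D) * ρ^3 := by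
    calc |s + e|^3 * Real.exp |s + e| ≤ (K * ρ)^3 * Real.exp (K * D) := by
          apply mul_le_mul (pow_le_pow_left₀ (abs_nonneg _) huρ 3) _ (Real.exp_pos _).le (by positivity)
          exact Real.exp_le_exp.2 (huρ.trans (mul_le_mul_of_nonneg_left hρD (by linarith)))
      _ = _ := by ring
  have hB : (s + e)^2 ≤ s^2 + (2 * K + K^2 * D) * ρ^3 := by
    have h1 : s * e ≤ ρ * (ρ^2 * K) := by
      calc s * e ≤ |s * e| := le_abs_self _
        _ = |s| * |e| := abs_mul _ _
        _ ≤ _ := mul_le_mul hsρ heρ (abs_nonneg _) hρ0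
    have h2 : e^2 ≤ (ρ^2 * K)^2 := by
      rw [← sq_abs]; exact pow_le_pow_left₀ (abs_nonneg _) heρ 2
    have h3 : (ρ^2 * K)^2 ≤ K^2 * D * ρ^3 := by
      calc (ρ^2 * K)^2 = (K^2 * ρ^3) * ρ := by ring
        _ ≤ (K^2 * ρ^3) * D := mul_le_mul_of_nonneg_left hρD (by positivity)
        _ = _ := by ring
    nlinarith
  have hv' : e = -v/2 + κ := rfl
  nlinarith
end PartA
section PartB
open MeasureTheory ProbabilityTheory Matrix
open scoped ENNReal RealInnerProductSpace

variable {E : Type*} [NormedAddCommGroup E] [InnerProductSpace ℝ E] [FiniteDimensional ℝ E]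
  [MeasurableSpace E] [BorelSpace E]

theorem gh_int_inner (v : E) : ∫ y, ⟪v, y⟫ ∂(ProbabilityTheory.stdGaussian E) = 0 :=
  integral_strongDual_stdGaussian (innerSL ℝ v)

theorem gh_int_inner_sq (v : E) : ∫ y, ⟪v, y⟫^2 ∂(ProbabilityTheory.stdGaussian E) = ‖v‖^2 := by
  have h := variance_dual_stdGaussian (E := E) (innerSL ℝ v)
  rw [variance_of_integral_eq_zero (by fun_prop) (integral_strongDual_stdGaussian _)] at h
  simpa using h

theorem gh_integrable_pow (k : ℕ) :
    Integrable (fun y : E => (1 + ‖y‖)^k) (ProbabilityTheory.stdGaussian E) := by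
  have h : MemLp (fun y : E => 1 + ‖y‖) (k : ℝ≥0∞) (ProbabilityTheory.stdGaussian E) :=
by
    have h0 := (IsGaussian.memLp_id (ProbabilityTheory.stdGaussian E) (k : ℝ≥0∞) (by simp)).norm
    have h1 : MemLp (fun _ : E => (1 : ℝ)) (k : ℝ≥0∞) (ProbabilityTheory.stdGaussian E) := memLp_const 1
    exact h1.add h0
  have := h.integrable_norm_pow'
  refine this.congr (Filter.Eventually.of_forall fun y => ?_)
  simp only [Real.norm_eq_abs]
  rw [abs_of_nonneg (by positivity)]

theorem gh_integrable_inner (v : E) :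
    Integrable (fun y : E => ⟪v, y⟫) (ProbabilityTheory.stdGaussian E) := by
  refine ((gh_integrable_pow (E := E) 1).const_mul ‖v‖).mono' (by fun_prop) (.of_forall fun y => ?_)
  refine (norm_inner_le_norm v y).trans (mul_le_mul_of_nonneg_left (by linarith) (norm_nonneg _))

theorem gh_integrable_inner_sq (v : E) :
    Integrable (fun y : E => ⟪v, y⟫^2) (ProbabilityTheory.stdGaussian E) := by
  refine ((gh_integrable_pow (E := E) 2).const_mul (‖v‖^2)).mono' (by fun_prop) (.of_forall fun y => ?_)
  rw [norm_pow, ← mul_pow]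
  refine pow_le_pow_left₀ (norm_nonneg _) ?_ 2
  refine (norm_inner_le_norm v y).trans (mul_le_mul_of_nonneg_left (by linarith) (norm_nonneg _))

theorem gh_integrable_normsq :
    Integrable (fun y : E => ‖y‖^2) (ProbabilityTheory.stdGaussian E) := by
  refine ((gh_integrable_pow (E := E) 2)).mono' (by fun_prop) (.of_forall fun y => ?_)
  rw [norm_pow, norm_norm]
  exact pow_le_pow_left₀ (norm_nonneg _) (by linarith) 2

/-- Stability of the standard Gaussian. -/
theorem gh_stable_map (a b c : ℝ) (h : a^2 + b^2 = c^2) :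
    ((ProbabilityTheory.stdGaussian E).prod (ProbabilityTheory.stdGaussian E)).map
      (fun w => a • w.1 + b • w.2) = (ProbabilityTheory.stdGaussian E).map (fun y => c • y) := by
  have h1 : ((ProbabilityTheory.stdGaussian E).prod (ProbabilityTheory.stdGaussian E)).map
      (fun w => a • w.1 + b • w.2) = ((ProbabilityTheory.stdGaussian E).map (fun y => a • y)) ∗
        ((ProbabilityTheory.stdGaussian E).map (fun y => b • y)) := by
    rw [Measure.conv, Measure.map_prod_map _ _ (by fun_prop) (by fun_prop),
      Measure.map_map (by fun_prop) (by fun_prop)]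
    rfl
  rw [h1]
  have i1 : IsProbabilityMeasure ((ProbabilityTheory.stdGaussian E).map (fun y => a • y)) :=
    Measure.isProbabilityMeasure_map (by fun_prop)
  have i2 : IsProbabilityMeasure ((ProbabilityTheory.stdGaussian E).map (fun y => b • y)) :=
    Measure.isProbabilityMeasure_map (by fun_prop)
  have i3 : IsProbabilityMeasure ((ProbabilityTheory.stdGaussian E).map (fun y => c • y)) :=
    Measure.isProbabilityMeasure_map (by fun_prop)
  apply Measure.ext_of_charFun
  ext t
  rw [charFun_conv, charFun_map_smul, charFun_map_smul, charFun_map_smul, charFun_stdGaussian,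
    charFun_stdGaussian, charFun_stdGaussian, ← Complex.exp_add]
  congr 1
  simp only [norm_smul, Complex.ofReal_mul, mul_pow, ← Complex.ofReal_pow, Real.norm_eq_abs, sq_abs, ← h]
  push_cast; ring

theorem gh_stable (F : E → ℝ) (hF : Measurable F) (B : ℝ) (hB : ∀ z, |F z| ≤ B) (z : E)
    (a b c : ℝ) (h : a^2 + b^2 = c^2) :
    ∫ y, ∫ y', F (z + a • y + b • y') ∂(ProbabilityTheory.stdGaussian E)
      ∂(ProbabilityTheory.stdGaussian E) = ∫ y, F (z + c • y) ∂(ProbabilityTheory.stdGaussian E) := by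
  have h1 : ∫ y, F (z + c • y) ∂(ProbabilityTheory.stdGaussian E) =
      ∫ y, F (z + y) ∂((ProbabilityTheory.stdGaussian E).map (fun y => c • y)) := by
    rw [integral_map (by fun_prop) (Measurable.aestronglyMeasurable (by fun_prop))]
  rw [h1, ← gh_stable_map a b c h, integral_map (by fun_prop) (Measurable.aestronglyMeasurable (by fun_prop)), integral_prod]
  · simp only [add_assoc]
  · refine Integrable.of_bound (Measurable.aestronglyMeasurable (by fun_prop)) B (.of_forall fun w => ?_)
    exact hB _

structure GHNice (V : Submodule ℝ E) (a b L M : ℝ) (h : E → ℝ) : Prop where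
  meas : Measurable h
  lb : ∀ z, a ≤ h z
  ub : ∀ z, h z ≤ b
  grad : ∃ G : E → E, Measurable G ∧ (∀ z, G z ∈ V) ∧ (∀ z, ‖G z‖ ≤ L) ∧
    ∀ z y, |h (z + y) - h z - ⟪G z, y⟫| ≤ M * ‖y‖^2

theorem gh_integrable_of_bdd {F : E → ℝ} {B : ℝ} (hF : Measurable F) (hB : ∀ z, |F z| ≤ B) (z : E) (c : ℝ) :
    Integrable (fun y => F (z + c • y)) (ProbabilityTheory.stdGaussian E) :=
  Integrable.of_bound (Measurable.aestronglyMeasurable (by fun_prop)) B (.of_forall fun w => hB _)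

theorem GHNice.abs_le {V : Submodule ℝ E} {a b L M : ℝ} {h : E → ℝ} (ha : 0 < a)
    (hh : GHNice V a b L M h) (z : E) : |h z| ≤ b := by
  rw [abs_of_nonneg (ha.le.trans (hh.lb z))]; exact hh.ub z

theorem GHNice.avg {V : Submodule ℝ E} {a b L M : ℝ} {h : E → ℝ} (ha : 0 < a)
    (hh : GHNice V a b L M h) (ε : ℝ) :
    GHNice V a b L M (fun z => ∫ y, h (z + ε • y) ∂(ProbabilityTheory.stdGaussian E)) := by
  have hint : ∀ z, Integrable (fun y => h (z + ε • y)) (ProbabilityTheory.stdGaussian E) :=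
    fun z => gh_integrable_of_bdd hh.meas (hh.abs_le ha) z ε
  obtain ⟨G, hGm, hGV, hGL, hGM⟩ := hh.grad
  have hm := hh.meas
  have hGint : ∀ z, Integrable (fun y => G (z + ε • y)) (ProbabilityTheory.stdGaussian E) :=
    fun z => Integrable.of_bound (Measurable.aestronglyMeasurable (by fun_prop)) L (.of_forall fun w => hGL _)
  refine ⟨?_, ?_, ?_, fun z => ∫ y, G (z + ε • y) ∂(ProbabilityTheory.stdGaussian E), ?_, ?_, ?_, ?_⟩
  · exact (StronglyMeasurable.integral_prod_right'
      (f := fun w : E × E => h (w.1 + ε • w.2)) (by fun_prop)).measurable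
  · intro z
    calc a = ∫ y, a ∂(ProbabilityTheory.stdGaussian E) := by simp
      _ ≤ _ := integral_mono (integrable_const _) (hint z) (fun y => hh.lb _)
  · intro z
    calc _ ≤ ∫ y, b ∂(ProbabilityTheory.stdGaussian E) :=
          integral_mono (hint z) (integrable_const _) (fun y => hh.ub _)
      _ = b := by simp
  · have : StronglyMeasurable (fun w : E × E => G (w.1 + ε • w.2)) :=
      Measurable.stronglyMeasurable (by fun_prop)
    exact (StronglyMeasurable.integral_prod_right' this).measurable
  · intro z
    exact V.convex.integral_mem V.closed_of_finiteDimensional (.of_forall fun y => hGV _) (hGint z)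
  · intro z
    refine (norm_integral_le_of_norm_le_const (.of_forall fun y => hGL _)).trans ?_
    simp
  · intro z y
    have e1 : ⟪∫ y', G (z + ε • y') ∂(ProbabilityTheory.stdGaussian E), y⟫ =
        ∫ y', ⟪G (z + ε • y'), y⟫ ∂(ProbabilityTheory.stdGaussian E) := by
      rw [real_inner_comm, ← integral_inner (hGint z)]
      simp only [real_inner_comm]
    have i1 : Integrable (fun y' => ⟪G (z + ε • y'), y⟫) (ProbabilityTheory.stdGaussian E) := (hGint z).inner_const y
    simp only
    have i2 : Integrable (fun y' => h (z + y + ε • y') - h (z + ε • y')) (ProbabilityTheory.stdGaussian E) :=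
      (hint _).sub (hint _)
    rw [e1, ← integral_sub (hint _) (hint _), ← integral_sub i2 i1, ← Real.norm_eq_abs]
    refine (norm_integral_le_of_norm_le_const (C := M * ‖y‖^2) (.of_forall fun y' => ?_)).trans ?_
    · rw [Real.norm_eq_abs, add_right_comm]; exact hGM _ _
    · simp

/-- the pointwise estimate after Taylor expansion of the square terms -/
theorem gh_quad {m : ℕ} (p t x : Fin m → ℝ) (pm η θ : ℝ) (hpm : ∀ i, |p i| ≤ pm)
    (h1 : ∀ i, |t i - x i| ≤ η) (h2 : ∀ i, |t i| ≤ θ) (h3 : ∀ i, |x i| ≤ θ) (hη : 0 ≤ η) (hθ : 0 ≤ θ) :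
    (∑ i, t i)^2 - ∑ i, p i * (t i)^2 ≤ (∑ i, x i)^2 - ∑ i, p i * (x i)^2
      + (2 * m^2 + 2 * m * pm) * (η * θ) := by
  have a1 : (∑ i, t i)^2 - (∑ i, x i)^2 ≤ (m * η) * (m * (2 * θ)) := by
    have : (∑ i, t i)^2 - (∑ i, x i)^2 = (∑ i, (t i - x i)) * (∑ i, (t i + x i)) := by
      rw [Finset.sum_sub_distrib, Finset.sum_add_distrib]; ring
    rw [this]
    refine (le_abs_self _).trans ?_
    rw [abs_mul]
    apply mul_le_mul
    · refine (Finset.abs_sum_le_sum_abs _ _).trans ((Finset.sum_le_sum fun i _ => h1 i).trans (by simp))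
    · refine (Finset.abs_sum_le_sum_abs _ _).trans ((Finset.sum_le_sum (g := fun _ => 2 * θ) fun i _ => ?_).trans (by simp))
      exact (abs_add_le _ _).trans (by linarith [h2 i, h3 i])
    · positivity
    · positivity
  have a2 : ∑ i, p i * (x i)^2 - ∑ i, p i * (t i)^2 ≤ m * (pm * (η * (2 * θ))) := by
    rw [← Finset.sum_sub_distrib]
    refine (Finset.sum_le_sum (g := fun _ => (pm * (η * (2 * θ)))) fun i _ => ?_).trans (by simp)
    have : p i * (x i)^2 - p i * (t i)^2 = p i * (-(t i - x i) * (t i + x i)) := by ring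
    rw [this]
    refine (le_abs_self _).trans ?_
    rw [abs_mul, abs_mul, abs_neg]
    have hp0 := (abs_nonneg (p i)).trans (hpm i)
    apply mul_le_mul (hpm i) _ (by positivity) hp0
    apply mul_le_mul (h1 i) _ (by positivity) hη
    exact (abs_add_le _ _).trans (by linarith [h2 i, h3 i])
  nlinarith
end PartB
section PartC
open MeasureTheory ProbabilityTheory Matrix
open scoped ENNReal RealInnerProductSpace

variable {E : Type*} [NormedAddCommGroup E] [InnerProductSpace ℝ E] [FiniteDimensional ℝ E]
  [MeasurableSpace E] [BorelSpace E]

set_option maxHeartbeats 1000000 in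
theorem gh_step {m : ℕ} (V : Fin m → Submodule ℝ E) (p : Fin m → ℝ) (hp : ∀ i, 1 ≤ p i)
    (hV : ∀ v : Fin m → E, (∀ i, v i ∈ V i) → ‖∑ i, v i‖^2 ≤ ∑ i, p i * ‖v i‖^2)
    (a b L M : ℝ) (ha : 0 < a) (hab : a ≤ b) (hL : 0 ≤ L) (hM : 0 ≤ M) :
    ∃ C : ℝ, 0 ≤ C ∧ ∀ ε : ℝ, 0 ≤ ε → ε ≤ 1 → ∀ h : Fin m → E → ℝ,
      (∀ i, GHNice (V i) a b L M (h i)) → ∀ z,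
      ∫ y, ∏ i, (h i (z + ε • y)) ^ (1 / p i) ∂(ProbabilityTheory.stdGaussian E) ≤
        ∏ i, (∫ y, h i (z + ε • y) ∂(ProbabilityTheory.stdGaussian E)) ^ (1 / p i) + C * ε^3 := by
  set γ := ProbabilityTheory.stdGaussian E with hγ
  have hb : 0 < b := ha.trans_le hab
  obtain ⟨CR, hCR0, hCR⟩ := gh_prod_le m (b / a) (by positivity)
  set σ : ℝ := ∫ y : E, ‖y‖^2 ∂γ with hσ
  have hσ0 : 0 ≤ σ := integral_nonneg fun y => by positivity
  set D : ℝ := M * (1 + σ) with hD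
  have hD0 : 0 ≤ D := by positivity
  set C1 : ℝ := D / a with hC1
  have hC10 : 0 ≤ C1 := by positivity
  set θ₀ : ℝ := (L + D) / a with hθ₀
  have hθ₀0 : 0 ≤ θ₀ := by positivity
  set pm : ℝ := ∑ i, |p i| with hpm
  have hpm0 : 0 ≤ pm := Finset.sum_nonneg fun i _ => abs_nonneg _
  have hpmi : ∀ i, |p i| ≤ pm := fun i =>
    Finset.single_le_sum (f := fun i => |p i|) (fun i _ => abs_nonneg _) (Finset.mem_univ i)
  set C2 : ℝ := (2 * m^2 + 2 * m * pm) / 2 * (C1 * θ₀) + CR * (m * θ₀)^3 with hC2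
  have hC20 : 0 ≤ C2 := by positivity
  set W6 : ℝ := ∫ y : E, (1 + ‖y‖)^6 ∂γ with hW6
  have hW60 : 0 ≤ W6 := integral_nonneg fun y => by positivity
  set B : ℝ := (max b 1)^m with hB
  have hB0 : 0 ≤ B := by positivity
  refine ⟨B * (C2 * W6), by positivity, ?_⟩
  intro ε hε0 hε1 h hh z
  have hε2 : ε^2 ≤ ε := by nlinarith
  have hp0 : ∀ i, 0 < p i := fun i => by linarith [hp i]
  have hq0 : ∀ i, 0 < 1 / p i := fun i => by have := hp0 i; positivity
  have hq1 : ∀ i, 1 / p i ≤ 1 := fun i => by rw [div_le_one (hp0 i)]; exact hp i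
  have hmeas : ∀ i, Measurable (h i) := fun i => (hh i).meas
  have hint : ∀ i, Integrable (fun y => h i (z + ε • y)) γ :=
    fun i => gh_integrable_of_bdd (hh i).meas ((hh i).abs_le ha) z ε
  set mn : Fin m → ℝ := fun i => ∫ y, h i (z + ε • y) ∂γ with hmn
  have hmna : ∀ i, a ≤ mn i := fun i => ((hh i).avg ha ε).lb z
  have hmnb : ∀ i, mn i ≤ b := fun i => ((hh i).avg ha ε).ub z
  have hmn0 : ∀ i, 0 < mn i := fun i => ha.trans_le (hmna i)
  choose G hGm hGV hGL hGM using fun i => (hh i).grad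
  have hGM' : ∀ i y, |h i (z + ε • y) - h i z - ε * ⟪G i z, y⟫| ≤ M * (ε^2 * ‖y‖^2) := by
    intro i y
    have := hGM i z (ε • y)
    rwa [real_inner_smul_right, norm_smul, mul_pow, Real.norm_eq_abs, sq_abs] at this
  -- mean versus value
  have hmnz : ∀ i, |mn i - h i z| ≤ M * ε^2 * σ := by
    intro i
    have e : mn i - h i z = ∫ y, (h i (z + ε • y) - h i z - ε * ⟪G i z, y⟫) ∂γ := by
      have j1 : Integrable (fun y => h i (z + ε • y) - h i z) γ := (hint i).sub (integrable_const _)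
      have j2 : Integrable (fun y => ε * ⟪G i z, y⟫) γ := (gh_integrable_inner (G i z)).const_mul ε
      rw [integral_sub j1 j2, integral_sub (hint i) (integrable_const _), integral_const_mul,
        gh_int_inner]
      simp [hmn]
    rw [e, ← Real.norm_eq_abs]
    refine (norm_integral_le_of_norm_le ((gh_integrable_normsq (E := E)).const_mul (M * ε^2))
      (.of_forall fun y => ?_)).trans ?_
    · rw [Real.norm_eq_abs]; exact (hGM' i y).trans (by linarith)
    · rw [integral_const_mul]
  set r : Fin m → E → ℝ := fun i y => (h i (z + ε • y) - mn i) / mn i with hr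
  set w : Fin m → E := fun i => (1 / p i / mn i) • G i z with hw
  have hwV : ∀ i, w i ∈ V i := fun i => (V i).smul_mem _ (hGV i z)
  set W : E → ℝ := fun y => 1 + ‖y‖ with hW
  have hW1 : ∀ y, 1 ≤ W y := fun y => by simp [hW]
  have hδ : ∀ i y, |h i (z + ε • y) - mn i - ε * ⟪G i z, y⟫| ≤ ε^2 * D * (W y)^2 := by
    intro i y
    have e : h i (z + ε • y) - mn i - ε * ⟪G i z, y⟫ =
      (h i (z + ε • y) - h i z - ε * ⟪G i z, y⟫) - (mn i - h i z) := by ring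
    rw [e]
    have h1 : ‖y‖^2 ≤ (W y)^2 := pow_le_pow_left₀ (norm_nonneg _) (by simp [hW]) 2
    have h2 : 1 ≤ (W y)^2 := one_le_pow₀ (hW1 y)
    calc _ ≤ M * (ε^2 * ‖y‖^2) + M * ε^2 * σ := (abs_sub _ _).trans (add_le_add (hGM' i y) (hmnz i))
      _ ≤ M * (ε^2 * (W y)^2) + M * ε^2 * σ * (W y)^2 := by
        apply add_le_add
        · gcongr
        · exact le_mul_of_one_le_right (by positivity) h2
      _ = _ := by rw [hD]; ring
  have hlin : ∀ i y, |ε * ⟪G i z, y⟫| ≤ ε * L * (W y)^2 := by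
    intro i y
    rw [abs_mul, abs_of_nonneg hε0, mul_assoc]
    refine mul_le_mul_of_nonneg_left ?_ hε0
    refine (abs_real_inner_le_norm _ _).trans ?_
    refine mul_le_mul (hGL i z) ?_ (norm_nonneg _) hL
    have : ‖y‖ ≤ W y := by simp [hW]
    nlinarith [hW1 y]
  have hδ' : ∀ i y, |h i (z + ε • y) - mn i| ≤ ε * (L + D) * (W y)^2 := by
    intro i y
    have e : h i (z + ε • y) - mn i =
      (h i (z + ε • y) - mn i - ε * ⟪G i z, y⟫) + ε * ⟪G i z, y⟫ := by ring
    rw [e]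
    refine (abs_add_le _ _).trans ((add_le_add (hδ i y) (hlin i y)).trans ?_)
    have : ε^2 * D * (W y)^2 ≤ ε * D * (W y)^2 := by gcongr
    linarith
  have hdiv : ∀ i (A Bd : ℝ), |A| ≤ Bd → |A / mn i| ≤ Bd / a := by
    intro i A Bd hA
    rw [abs_div, abs_of_pos (hmn0 i)]
    exact div_le_div₀ ((abs_nonneg _).trans hA) hA ha (hmna i)
  have hrθ : ∀ i y, |r i y| ≤ ε * θ₀ * (W y)^2 := by
    intro i y
    refine (hdiv i _ _ (hδ' i y)).trans (le_of_eq ?_)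
    rw [hθ₀]; ring
  have hrR : ∀ i y, |r i y| ≤ b / a := by
    intro i y
    refine hdiv i _ _ ?_
    rw [abs_le]; constructor <;> linarith [(hh i).lb (z + ε • y), (hh i).ub (z + ε • y), hmna i, hmnb i]
  have hr1 : ∀ i y, 1 + r i y = h i (z + ε • y) / mn i := by
    intro i y
    have := (hmn0 i).ne'
    simp only [hr]; field_simp; ring
  have hrm1 : ∀ i y, -1 < r i y := by
    intro i y
    have := hr1 i y
    have h2 : 0 < h i (z + ε • y) / mn i := div_pos (ha.trans_le ((hh i).lb _)) (hmn0 i)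
    linarith
  have hqr : ∀ i (A : ℝ), |1 / p i * A| ≤ |A| := by
    intro i A
    rw [abs_mul, abs_of_pos (hq0 i)]
    exact mul_le_of_le_one_left (abs_nonneg _) (hq1 i)
  -- pointwise bound
  have hpt : ∀ y, ∏ i, (1 + r i y) ^ (1 / p i) ≤ 1 + ∑ i, 1 / p i * r i y
      + ε^2 / 2 * (⟪∑ i, w i, y⟫^2 - ∑ i, p i * ⟪w i, y⟫^2) + C2 * ε^3 * (W y)^6 := by
    intro y
    have h1 := hCR (fun i => 1 / p i) (fun i => r i y) hq0 hq1 (fun i => hrm1 i y) (fun i => hrR i y)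
    have hxi : ∀ i, ε * ⟪w i, y⟫ = 1 / p i * (ε * ⟪G i z, y⟫ / mn i) := by
      intro i; simp only [hw, real_inner_smul_left]; ring
    have h2 := gh_quad p (fun i => 1 / p i * r i y) (fun i => ε * ⟪w i, y⟫) pm
      (ε^2 * C1 * (W y)^2) (ε * θ₀ * (W y)^2) hpmi
      (by
        intro i
        rw [hxi, ← mul_sub, hr, ← sub_div]
        refine (hqr i _).trans ((hdiv i _ _ (hδ i y)).trans (le_of_eq ?_))
        rw [hC1]; ring)
      (fun i => (hqr i _).trans (hrθ i y))
      (by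
        intro i
        rw [hxi]
        refine (hqr i _).trans ((hdiv i _ _ (hlin i y)).trans ?_)
        have : ε * L * W y ^ 2 ≤ ε * (L + D) * W y ^ 2 := by gcongr; linarith
        calc _ ≤ ε * (L + D) * W y ^ 2 / a := by gcongr
          _ = _ := by rw [hθ₀]; ring) (by positivity) (by positivity)
    have e1 : ∑ i, p i * (1 / p i * r i y)^2 = ∑ i, 1 / p i * (r i y)^2 :=
      Finset.sum_congr rfl fun i _ => by have := (hp0 i).ne'; field_simp
    have e2 : ∑ i, p i * (ε * ⟪w i, y⟫)^2 = ε^2 * ∑ i, p i * ⟪w i, y⟫^2 := by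
      rw [Finset.mul_sum]; exact Finset.sum_congr rfl fun i _ => by ring
    have e3 : ∑ i, ε * ⟪w i, y⟫ = ε * ⟪∑ i, w i, y⟫ := by rw [sum_inner, Finset.mul_sum]
    rw [e1, e2, e3] at h2
    have h3 : (∑ i, |r i y|)^3 ≤ (m * (ε * θ₀ * (W y)^2))^3 := by
      refine pow_le_pow_left₀ (Finset.sum_nonneg fun i _ => abs_nonneg _) ?_ 3
      exact (Finset.sum_le_sum fun i _ => hrθ i y).trans (by simp)
    have h4 : CR * (∑ i, |r i y|)^3 ≤ CR * (m * θ₀)^3 * (ε^3 * (W y)^6) :=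
      (mul_le_mul_of_nonneg_left h3 hCR0).trans (le_of_eq (by ring))
    have h5 : (2 * m^2 + 2 * m * pm) / 2 * (ε^2 * C1 * (W y)^2 * (ε * θ₀ * (W y)^2)) ≤
        (2 * m^2 + 2 * m * pm) / 2 * (C1 * θ₀) * (ε^3 * (W y)^6) := by
      have : (W y)^4 ≤ (W y)^6 := pow_le_pow_right₀ (hW1 y) (by norm_num)
      calc _ = (2 * m^2 + 2 * m * pm) / 2 * (C1 * θ₀) * (ε^3 * (W y)^4) := by ring
        _ ≤ _ := by gcongr
    have h6 : C2 * ε^3 * (W y)^6 = (2 * m^2 + 2 * m * pm) / 2 * (C1 * θ₀) * (ε^3 * (W y)^6)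
        + CR * (m * θ₀)^3 * (ε^3 * (W y)^6) := by rw [hC2]; ring
    rw [h6]
    linarith
  -- integrate
  have hrm : ∀ i, Measurable (r i) := fun i => by
    have := hmeas i
    simp only [hr]; fun_prop
  have ir : ∀ i, Integrable (r i) γ := fun i =>
    ((hint i).sub (integrable_const _)).div_const _
  have ir0 : ∀ i, ∫ y, r i y ∂γ = 0 := by
    intro i
    simp only [hr]
    rw [integral_div, integral_sub (hint i) (integrable_const _)]
    simp [hmn]
  have iL : Integrable (fun y => ∏ i, (1 + r i y) ^ (1 / p i)) γ := by
    refine Integrable.of_bound (Measurable.aestronglyMeasurable (by fun_prop)) (∏ i, (1 + b / a) ^ (1 / p i)) (.of_forall fun y => ?_)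
    rw [Real.norm_eq_abs, abs_of_nonneg]
    · refine Finset.prod_le_prod (fun i _ => Real.rpow_nonneg (by linarith [hrm1 i y]) _) fun i _ => ?_
      exact Real.rpow_le_rpow (by linarith [hrm1 i y]) (by linarith [(abs_le.1 (hrR i y)).2]) (hq0 i).le
    · exact Finset.prod_nonneg fun i _ => Real.rpow_nonneg (by linarith [hrm1 i y]) _
  have iA : Integrable (fun y => ∑ i, 1 / p i * r i y) γ :=
    integrable_finsetSum _ fun i _ => (ir i).const_mul _
  have iA1 : Integrable (fun y => 1 + ∑ i, 1 / p i * r i y) γ := (integrable_const _).add iA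
  have iQ1 : Integrable (fun y => ⟪∑ i, w i, y⟫^2) γ := gh_integrable_inner_sq _
  have iQ2 : Integrable (fun y => ∑ i, p i * ⟪w i, y⟫^2) γ :=
    integrable_finsetSum _ fun i _ => (gh_integrable_inner_sq _).const_mul _
  have iQ : Integrable (fun y => ε^2 / 2 * (⟪∑ i, w i, y⟫^2 - ∑ i, p i * ⟪w i, y⟫^2)) γ :=
    (iQ1.sub iQ2).const_mul _
  have iAQ : Integrable (fun y => 1 + ∑ i, 1 / p i * r i y + ε^2 / 2 * (⟪∑ i, w i, y⟫^2 - ∑ i, p i * ⟪w i, y⟫^2)) γ :=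
    iA1.add iQ
  have iW : Integrable (fun y => C2 * ε^3 * (W y)^6) γ := (gh_integrable_pow 6).const_mul _
  have hmain : ∫ y, ∏ i, (1 + r i y) ^ (1 / p i) ∂γ ≤ 1 + C2 * ε^3 * W6 := by
    refine (integral_mono iL (iAQ.add iW) hpt).trans ?_
    have e0 : ∫ y, ∑ i, 1 / p i * r i y ∂γ = 0 := by
      rw [integral_finsetSum _ fun i _ => (ir i).const_mul _]
      refine Finset.sum_eq_zero fun i _ => ?_
      rw [integral_const_mul, ir0, mul_zero]
    have e1 : ∫ y, ∑ i, p i * ⟪w i, y⟫^2 ∂γ = ∑ i, p i * ‖w i‖^2 := by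
      rw [integral_finsetSum _ fun i _ => (gh_integrable_inner_sq _).const_mul _]
      refine Finset.sum_congr rfl fun i _ => ?_
      rw [integral_const_mul, gh_int_inner_sq]
    have : ∫ y, ((1 + ∑ i, 1 / p i * r i y + ε^2 / 2 * (⟪∑ i, w i, y⟫^2 - ∑ i, p i * ⟪w i, y⟫^2))
        + C2 * ε^3 * (W y)^6) ∂γ = 1 + ε^2/2 * (‖∑ i, w i‖^2 - ∑ i, p i * ‖w i‖^2) + C2 * ε^3 * W6 := by
      rw [integral_add iAQ iW, integral_add iA1 iQ, integral_add (integrable_const _) iA, e0,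
        integral_const_mul, integral_const_mul, integral_sub iQ1 iQ2, e1, gh_int_inner_sq]
      simp [hW6, hW]
    refine (le_of_eq this).trans ?_
    have h9 := hV w hwV
    have : ε^2/2 * (‖∑ i, w i‖^2 - ∑ i, p i * ‖w i‖^2) ≤ 0 :=
      mul_nonpos_of_nonneg_of_nonpos (by positivity) (by linarith)
    linarith
  have efac : ∀ y, ∏ i, (h i (z + ε • y)) ^ (1 / p i) = (∏ i, (mn i) ^ (1 / p i)) * ∏ i, (1 + r i y) ^ (1 / p i) := by
    intro y
    rw [← Finset.prod_mul_distrib]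
    refine Finset.prod_congr rfl fun i _ => ?_
    rw [← Real.mul_rpow (hmn0 i).le (by linarith [hrm1 i y]), hr1, mul_div_cancel₀ _ (hmn0 i).ne']
  have hPB : ∏ i, (mn i) ^ (1 / p i) ≤ B := by
    calc _ ≤ ∏ i : Fin m, max b 1 := by
          refine Finset.prod_le_prod (fun i _ => Real.rpow_nonneg (hmn0 i).le _) fun i _ => ?_
          calc (mn i) ^ (1 / p i) ≤ (max b 1) ^ (1 / p i) :=
                Real.rpow_le_rpow (hmn0 i).le ((hmnb i).trans (le_max_left _ _)) (hq0 i).le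
            _ ≤ (max b 1) ^ (1 : ℝ) := Real.rpow_le_rpow_of_exponent_le (le_max_right _ _) (hq1 i)
            _ = _ := Real.rpow_one _
      _ = B := by simp [hB]
  have hP0 : 0 ≤ ∏ i, (mn i) ^ (1 / p i) := Finset.prod_nonneg fun i _ => Real.rpow_nonneg (hmn0 i).le _
  simp_rw [efac]
  rw [integral_const_mul]
  calc _ ≤ (∏ i, (mn i) ^ (1 / p i)) * (1 + C2 * ε^3 * W6) := mul_le_mul_of_nonneg_left hmain hP0
    _ = (∏ i, (mn i) ^ (1 / p i)) + (∏ i, (mn i) ^ (1 / p i)) * (C2 * ε^3 * W6) := by ring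
    _ ≤ (∏ i, (mn i) ^ (1 / p i)) + B * (C2 * ε^3 * W6) := by gcongr
    _ = _ := by ring

theorem gh_nice {m : ℕ} (V : Fin m → Submodule ℝ E) (p : Fin m → ℝ) (hp : ∀ i, 1 ≤ p i)
    (hV : ∀ v : Fin m → E, (∀ i, v i ∈ V i) → ‖∑ i, v i‖^2 ≤ ∑ i, p i * ‖v i‖^2)
    (a b L M : ℝ) (ha : 0 < a) (hab : a ≤ b) (hL : 0 ≤ L) (hM : 0 ≤ M) (h : Fin m → E → ℝ)
    (hh : ∀ i, GHNice (V i) a b L M (h i)) :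
      ∫ y, ∏ i, (h i y) ^ (1 / p i) ∂(ProbabilityTheory.stdGaussian E) ≤
        ∏ i, (∫ y, h i y ∂(ProbabilityTheory.stdGaussian E)) ^ (1 / p i) := by
  obtain ⟨C, hC0, hC⟩ := gh_step V p hp hV a b L M ha hab hL hM
  have hp0 : ∀ i, 0 < p i := fun i => by linarith [hp i]
  have hq0 : ∀ i, 0 < 1 / p i := fun i => by have := hp0 i; positivity
  have hbd : ∀ h : Fin m → E → ℝ, (∀ i, GHNice (V i) a b L M (h i)) → 
      Measurable (fun z => ∏ i, (h i z) ^ (1 / p i)) ∧ ∀ z, |∏ i, (h i z) ^ (1 / p i)| ≤ ∏ i, b ^ (1 / p i) := by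
    intro h hh
    have hm := fun i => (hh i).meas
    refine ⟨by fun_prop, fun z => ?_⟩
    rw [abs_of_nonneg (Finset.prod_nonneg fun i _ => Real.rpow_nonneg (ha.le.trans ((hh i).lb z)) _)]
    exact Finset.prod_le_prod (fun i _ => Real.rpow_nonneg (ha.le.trans ((hh i).lb z)) _)
      fun i _ => Real.rpow_le_rpow (ha.le.trans ((hh i).lb z)) ((hh i).ub z) (hq0 i).le
  have key : ∀ (ε : ℝ), 0 ≤ ε → ε ≤ 1 → ∀ k : ℕ, ∀ h : Fin m → E → ℝ, (∀ i, GHNice (V i) a b L M (h i)) →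
      ∀ z, ∫ y, ∏ i, (h i (z + (ε * √k) • y)) ^ (1 / p i) ∂(ProbabilityTheory.stdGaussian E) ≤
        ∏ i, (∫ y, h i (z + (ε * √k) • y) ∂(ProbabilityTheory.stdGaussian E)) ^ (1 / p i) + k * (C * ε^3) := by
    intro ε hε0 hε1 k
    induction k with
    | zero => intro h hh z; simp
    | succ k ih =>
      intro h hh z
      have hst : (ε * √k)^2 + ε^2 = (ε * √((k + 1 : ℕ) : ℝ))^2 := by
        rw [mul_pow, mul_pow, Real.sq_sqrt (by positivity), Real.sq_sqrt (by positivity)]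
        push_cast; ring
      have hav := fun i => (hh i).avg ha ε
      have e1 := gh_stable _ (hbd h hh).1 _ (hbd h hh).2 z _ _ _ hst
      have e2 := fun i => gh_stable _ (hh i).meas _ ((hh i).abs_le ha) z _ _ _ hst
      rw [← e1]
      simp_rw [← e2]
      have i1 := (gh_integrable_of_bdd (hbd _ hav).1 (hbd _ hav).2 z (ε * √k))
      have hmono : ∫ y, ∫ y', ∏ i, (h i (z + (ε * √k) • y + ε • y')) ^ (1 / p i)
          ∂(ProbabilityTheory.stdGaussian E) ∂(ProbabilityTheory.stdGaussian E)
          ≤ ∫ y, (∏ i, (∫ y', h i (z + (ε * √k) • y + ε • y') ∂(ProbabilityTheory.stdGaussian E)) ^ (1 / p i) + C * ε^3)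
          ∂(ProbabilityTheory.stdGaussian E) := by
        refine integral_mono ?_ (i1.add (integrable_const _)) fun y => hC ε hε0 hε1 h hh _
        have hm := (hbd h hh).1
        refine Integrable.of_bound (StronglyMeasurable.aestronglyMeasurable ?_) (∏ i, b ^ (1 / p i)) (.of_forall fun y => ?_)
        · refine StronglyMeasurable.integral_prod_right'
            (f := fun w : E × E => ∏ i, (h i (z + (ε * √k) • w.1 + ε • w.2)) ^ (1 / p i)) ?_
          refine Measurable.stronglyMeasurable ?_
          exact hm.comp (g := fun z => ∏ i, (h i z) ^ (1 / p i)) (f := fun w : E × E => z + (ε * √k) • w.1 + ε • w.2) (by fun_prop)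
        · refine (norm_integral_le_of_norm_le_const (C := ∏ i, b ^ (1 / p i)) (.of_forall fun y' => ?_)).trans (by simp)
          exact (hbd h hh).2 _
      refine hmono.trans ?_
      rw [integral_add i1 (integrable_const _)]
      have := ih _ hav z
      simp only [integral_const, probReal_univ, one_smul]
      push_cast
      linarith
  have hfin : ∀ k : ℕ, 
      ∫ y, ∏ i, (h i y) ^ (1 / p i) ∂(ProbabilityTheory.stdGaussian E) ≤
        ∏ i, (∫ y, h i y ∂(ProbabilityTheory.stdGaussian E)) ^ (1 / p i) + C * (1 / √((k + 1 : ℕ) : ℝ)) := by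
    intro k
    have hs : 1 ≤ √((k + 1 : ℕ) : ℝ) := by rw [Real.one_le_sqrt]; push_cast; linarith [(Nat.cast_nonneg k : (0:ℝ) ≤ k)]
    have hs0 : 0 < √((k + 1 : ℕ) : ℝ) := by linarith
    have hsq : √((k + 1 : ℕ) : ℝ)^2 = ((k + 1 : ℕ) : ℝ) := Real.sq_sqrt (by positivity)
    have := key (1 / √((k + 1 : ℕ) : ℝ)) (by positivity) (by rw [div_le_one hs0]; exact hs) (k + 1) h hh 0
    rw [one_div_mul_cancel hs0.ne'] at this
    simp only [one_smul, zero_add] at this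
    convert! this using 2
    rw [← hsq]
    simp only [Real.sqrt_sq hs0.le]
    field_simp
  have hlim : Filter.Tendsto (fun k : ℕ => ∏ i, (∫ y, h i y ∂(ProbabilityTheory.stdGaussian E)) ^ (1 / p i) + C * (1 / √((k + 1 : ℕ) : ℝ)))
      Filter.atTop (nhds (∏ i, (∫ y, h i y ∂(ProbabilityTheory.stdGaussian E)) ^ (1 / p i) + C * 0)) := by
    refine (Filter.Tendsto.const_mul _ ?_).const_add _
    simp_rw [one_div]
    exact tendsto_inv_atTop_zero.comp (Real.tendsto_sqrt_atTop.comp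
      ((tendsto_natCast_atTop_atTop (R := ℝ)).comp (Filter.tendsto_add_atTop_nat 1)))
  have := ge_of_tendsto' hlim hfin
  simpa using this
end PartC
section PartD
open MeasureTheory ProbabilityTheory Matrix
open scoped ENNReal RealInnerProductSpace

variable {E : Type*} [NormedAddCommGroup E] [InnerProductSpace ℝ E] [FiniteDimensional ℝ E]
  [MeasurableSpace E] [BorelSpace E]

theorem GHNice.mono {V : Submodule ℝ E} {a b L M b' L' M' : ℝ} {h : E → ℝ}
    (hh : GHNice V a b L M h) (hb : b ≤ b') (hL : L ≤ L') (hM : M ≤ M') : GHNice V a b' L' M' h := by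
  obtain ⟨G, h1, h2, h3, h4⟩ := hh.grad
  exact ⟨hh.meas, hh.lb, fun z => (hh.ub z).trans hb, G, h1, h2, fun z => (h3 z).trans hL,
    fun z y => (h4 z y).trans (mul_le_mul_of_nonneg_right hM (by positivity))⟩

theorem gh_nice_of_contDiff {n : ℕ} (s : Fin n → E) (g : (Fin n → ℝ) → ℝ) (hg : ContDiff ℝ 2 g)
    (hgs : HasCompactSupport g) (c K : ℝ) (hg0 : ∀ x, 0 ≤ g x) (hgK : ∀ x, g x ≤ K) :
    ∃ L M : ℝ, 0 ≤ L ∧ 0 ≤ M ∧ GHNice (Submodule.span ℝ (Set.range s)) c (K + c) L M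
      (fun z => g (fun j => ⟪s j, z⟫) + c) := by
  let A : E →L[ℝ] (Fin n → ℝ) := ContinuousLinearMap.pi (fun j => innerSL ℝ (s j))
  have hA : ∀ z, (fun j => ⟪s j, z⟫) = A z := fun z => rfl
  have hd1 : ContDiff ℝ 1 (fderiv ℝ g) := hg.fderiv_right (by norm_num)
  have hds : HasCompactSupport (fderiv ℝ g) := hgs.fderiv ℝ
  obtain ⟨C, hC⟩ := hds.exists_bound_of_continuous hd1.continuous
  obtain ⟨K', hK'⟩ := hd1.lipschitzWith_of_hasCompactSupport hds (by norm_num)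
  have hC0 : 0 ≤ C := (norm_nonneg _).trans (hC 0)
  have hdiff : Differentiable ℝ g := hg.differentiable (by norm_num)
  have taylor : ∀ u d : Fin n → ℝ, |g (u + d) - g u - fderiv ℝ g u d| ≤ K' * ‖d‖ * ‖d‖ := by
    intro u d
    have := (convex_closedBall u ‖d‖).norm_image_sub_le_of_norm_hasFDerivWithin_le'
      (f := g) (f' := fderiv ℝ g) (φ := fderiv ℝ g u) (C := K' * ‖d‖) (x := u) (y := u + d)
      (fun x _ => (hdiff x).hasFDerivAt.hasFDerivWithinAt)
      (fun x hx => (hK'.norm_sub_le x u).trans (mul_le_mul_of_nonneg_left (by simpa [dist_eq_norm] using hx) (by positivity)))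
      (by simp) (by simp)
    simpa using this
  refine ⟨∑ j : Fin n, C * ‖(fun k => if j = k then (1:ℝ) else 0 : Fin n → ℝ)‖ * ‖s j‖, K' * ‖A‖^2, by positivity, by positivity, ?_⟩
  refine ⟨?_, fun z => by simpa using hg0 _, fun z => by simpa using hgK _,
    fun z => ∑ j, (fderiv ℝ g (A z) (fun k => if j = k then (1:ℝ) else 0)) • s j, ?_, ?_, ?_, ?_⟩
  · simp only [hA]
    exact ((hg.continuous.comp A.continuous).add continuous_const).measurable
  · refine Continuous.measurable ?_
    refine continuous_finsetSum _ fun j _ => Continuous.smul ?_ continuous_const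
    exact (hd1.continuous.comp A.continuous).clm_apply continuous_const
  · intro z
    exact Submodule.sum_mem _ fun j _ => Submodule.smul_mem _ _ (Submodule.subset_span ⟨j, rfl⟩)
  · intro z
    refine (norm_sum_le _ _).trans (Finset.sum_le_sum fun j _ => ?_)
    rw [norm_smul]
    refine mul_le_mul_of_nonneg_right ?_ (norm_nonneg _)
    exact (ContinuousLinearMap.le_opNorm _ _).trans (mul_le_mul_of_nonneg_right (hC _) (norm_nonneg _))
  · intro z y
    have e : ⟪∑ j, (fderiv ℝ g (A z) (fun k => if j = k then (1:ℝ) else 0)) • s j, y⟫ = fderiv ℝ g (A z) (A y) := by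
      rw [sum_inner, show fderiv ℝ g (A z) (A y) = (fderiv ℝ g (A z)).toLinearMap (A y) from rfl,
        LinearMap.pi_apply_eq_sum_univ (fderiv ℝ g (A z)).toLinearMap (A y)]
      refine Finset.sum_congr rfl fun j _ => ?_
      rw [real_inner_smul_left, smul_eq_mul, mul_comm]
      rfl
    simp only [hA]
    rw [e, map_add]
    have := taylor (A z) (A y)
    have e2 : g (A z + A y) + c - (g (A z) + c) - fderiv ℝ g (A z) (A y) = g (A z + A y) - g (A z) - fderiv ℝ g (A z) (A y) := by ring
    rw [e2]
    refine this.trans ?_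
    have h1 := A.le_opNorm y
    calc K' * ‖A y‖ * ‖A y‖ = K' * ‖A y‖^2 := by ring
      _ ≤ K' * (‖A‖ * ‖y‖)^2 := by gcongr
      _ = _ := by ring

theorem gh_mollify {n : ℕ} (ν : Measure (Fin n → ℝ)) [IsFiniteMeasure ν] (g : (Fin n → ℝ) → ℝ) (hg : Continuous g)
    (hgs : HasCompactSupport g) (K : ℝ) (hg0 : ∀ x, 0 ≤ g x) (hgK : ∀ x, g x ≤ K) (δ : ℝ) (hδ : 0 < δ) :
    ∃ φ : (Fin n → ℝ) → ℝ, ContDiff ℝ 2 φ ∧ HasCompactSupport φ ∧ (∀ x, 0 ≤ φ x) ∧ (∀ x, φ x ≤ K) ∧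
      ∫ x, |g x - φ x| ∂ν ≤ δ := by
  let b : ℕ → ContDiffBump (0 : Fin n → ℝ) := fun k => ⟨1 / (2 * ((k : ℝ) + 1)), 1 / ((k : ℝ) + 1), by positivity, by
    apply one_div_lt_one_div_of_lt <;> linarith [(Nat.cast_nonneg k : (0:ℝ) ≤ k)]⟩
  let ψ : ℕ → (Fin n → ℝ) → ℝ := fun k => convolution ((b k).normed volume) g (ContinuousLinearMap.lsmul ℝ ℝ) volume
  have hψ : ∀ k x, ψ k x = ∫ t, (b k).normed volume t * g (x - t) := fun k x => rfl
  have hbi : ∀ k, Integrable ((b k).normed volume) := fun k => (b k).integrable_normed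
  have hint : ∀ k x, Integrable (fun t => (b k).normed volume t * g (x - t)) := by
    intro k x
    refine (hbi k).mul_bdd (c := K) ?_ (.of_forall fun t => ?_)
    · exact Continuous.aestronglyMeasurable (by fun_prop)
    · rw [Real.norm_eq_abs, abs_of_nonneg (hg0 _)]; exact hgK _
  have hψ0 : ∀ k x, 0 ≤ ψ k x := fun k x => by
    rw [hψ]; exact integral_nonneg fun t => mul_nonneg ((b k).nonneg_normed _) (hg0 _)
  have hψK : ∀ k x, ψ k x ≤ K := fun k x => by
    rw [hψ]
    calc _ ≤ ∫ t, (b k).normed volume t * K :=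
          integral_mono (hint k x) ((hbi k).mul_const K) fun t => mul_le_mul_of_nonneg_left (hgK _) ((b k).nonneg_normed _)
      _ = K := by rw [integral_mul_const, (b k).integral_normed, one_mul]
  have hψc : ∀ k, ContDiff ℝ 2 (ψ k) := fun k =>
    (b k).hasCompactSupport_normed.contDiff_convolution_left (n := 2) _ (b k).contDiff_normed hg.locallyIntegrable
  have hψs : ∀ k, HasCompactSupport (ψ k) := fun k =>
    HasCompactSupport.convolution _ (b k).hasCompactSupport_normed hgs
  have hlim : ∀ x, Filter.Tendsto (fun k => ψ k x) Filter.atTop (nhds (g x)) := by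
    intro x
    refine ContDiffBump.convolution_tendsto_right_of_continuous (φ := b) ?_ hg x
    exact tendsto_one_div_add_atTop_nhds_zero_nat
  have hlim2 : Filter.Tendsto (fun k => ∫ x, |g x - ψ k x| ∂ν) Filter.atTop (nhds (∫ x, 0 ∂ν)) := by
    refine tendsto_integral_of_dominated_convergence (fun _ => K) (fun k => ?_) (integrable_const _) (fun k => .of_forall fun x => ?_) (.of_forall fun x => ?_)
    · have := (hψc k).continuous
      exact Continuous.aestronglyMeasurable (by fun_prop)
    · rw [Real.norm_eq_abs, abs_abs, abs_le]
      constructor <;> linarith [hg0 x, hgK x, hψ0 k x, hψK k x]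
    · have := ((hlim x).const_sub (g x)).abs
      simpa using this
  rw [integral_zero] at hlim2
  obtain ⟨k, hk⟩ := (hlim2.eventually (eventually_le_nhds hδ)).exists
  exact ⟨ψ k, hψc k, hψs k, hψ0 k, hψK k, hk⟩

theorem gh_approx {n : ℕ} (ν : Measure (Fin n → ℝ)) [IsFiniteMeasure ν] (f : (Fin n → ℝ) → ℝ) (hf : Measurable f)
    (K : ℝ) (hf0 : ∀ x, 0 ≤ f x) (hfK : ∀ x, f x ≤ K) :
    ∃ φ : ℕ → (Fin n → ℝ) → ℝ, (∀ k, ContDiff ℝ 2 (φ k)) ∧ (∀ k, HasCompactSupport (φ k)) ∧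
      (∀ k x, 0 ≤ φ k x) ∧ (∀ k x, φ k x ≤ K) ∧
      ∀ᵐ x ∂ν, Filter.Tendsto (fun k => φ k x) Filter.atTop (nhds (f x)) := by
  have hK : 0 ≤ K := (hf0 0).trans (hfK 0)
  have hfi : Integrable f ν := Integrable.of_bound hf.aestronglyMeasurable K (.of_forall fun x => by
    rw [Real.norm_eq_abs, abs_of_nonneg (hf0 _)]; exact hfK _)
  have hbi : ∀ g : (Fin n → ℝ) → ℝ, Continuous g → (∀ x, 0 ≤ g x) → (∀ x, g x ≤ K) → Integrable g ν := fun g hg h0 hK =>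
    Integrable.of_bound hg.aestronglyMeasurable K (.of_forall fun x => by
      rw [Real.norm_eq_abs, abs_of_nonneg (h0 _)]; exact hK _)
  have step : ∀ δ : ℝ, 0 < δ → ∃ φ : (Fin n → ℝ) → ℝ, ContDiff ℝ 2 φ ∧ HasCompactSupport φ ∧ (∀ x, 0 ≤ φ x) ∧ (∀ x, φ x ≤ K) ∧
      ∫ x, |f x - φ x| ∂ν ≤ δ := by
    intro δ hδ
    obtain ⟨g0, hg0s, hg0d, hg0c, hg0i⟩ := hfi.exists_hasCompactSupport_integral_sub_le (half_pos hδ)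
    let g1 : (Fin n → ℝ) → ℝ := fun x => max 0 (min (g0 x) K)
    have hg1c : Continuous g1 := by fun_prop
    have hg1s : HasCompactSupport g1 := by
      refine hg0s.mono fun x hx => ?_
      contrapose! hx
      simp only [Function.mem_support, not_not] at hx ⊢
      simp [g1, hx, hK]
    have hg10 : ∀ x, 0 ≤ g1 x := fun x => le_max_left _ _
    have hg1K : ∀ x, g1 x ≤ K := fun x => max_le hK (min_le_right _ _)
    obtain ⟨φ, h1, h2, h3, h4, h5⟩ := gh_mollify ν g1 hg1c hg1s K hg10 hg1K (δ / 2) (half_pos hδ)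
    refine ⟨φ, h1, h2, h3, h4, ?_⟩
    have i1 := hbi g1 hg1c hg10 hg1K
    have i2 := hbi φ h1.continuous h3 h4
    calc ∫ x, |f x - φ x| ∂ν ≤ ∫ x, (‖f x - g0 x‖ + |g1 x - φ x|) ∂ν := by
          refine integral_mono (hfi.sub i2).abs ((hfi.sub hg0i).norm.add (i1.sub i2).abs) fun x => ?_
          have : |f x - g1 x| ≤ |f x - g0 x| := by
            have e : f x = max 0 (min (f x) K) := by rw [min_eq_left (hfK x), max_eq_right (hf0 x)]
            conv_lhs => rw [e]
            simp only [g1]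
            refine (abs_max_sub_max_le_max _ _ _ _).trans ?_
            simp only [sub_self, abs_zero]
            refine max_le (abs_nonneg _) ((abs_min_sub_min_le_max _ _ _ _).trans ?_)
            simp
          simp only [Real.norm_eq_abs]
          calc |f x - φ x| ≤ |f x - g1 x| + |g1 x - φ x| := abs_sub_le _ _ _
            _ ≤ _ := by linarith
      _ = ∫ x, ‖f x - g0 x‖ ∂ν + ∫ x, |g1 x - φ x| ∂ν := integral_add (hfi.sub hg0i).norm (i1.sub i2).abs
      _ ≤ δ := by linarith
  choose φ h1 h2 h3 h4 h5 using fun k : ℕ => step (1 / ((k : ℝ) + 1)) (by positivity)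
  have hi := fun k => hbi _ (h1 k).continuous (h3 k) (h4 k)
  have hconv : Filter.Tendsto (fun k => eLpNorm (φ k - f) 1 ν) Filter.atTop (nhds 0) := by
    have e : ∀ k, eLpNorm (φ k - f) 1 ν = ENNReal.ofReal (∫ x, |f x - φ k x| ∂ν) := by
      intro k
      rw [eLpNorm_one_eq_lintegral_enorm, ← ofReal_integral_norm_eq_lintegral_enorm ((hi k).sub hfi)]
      simp only [Pi.sub_apply, Real.norm_eq_abs, abs_sub_comm]
    simp_rw [e]
    rw [← ENNReal.ofReal_zero]
    refine ENNReal.tendsto_ofReal ?_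
    exact squeeze_zero (fun k => integral_nonneg fun x => abs_nonneg _) h5 tendsto_one_div_add_atTop_nhds_zero_nat
  have hm := tendstoInMeasure_of_tendsto_eLpNorm one_ne_zero (fun k => (hi k).aestronglyMeasurable) hf.aestronglyMeasurable hconv
  obtain ⟨ns, -, hns⟩ := hm.exists_seq_tendsto_ae
  exact ⟨fun k => φ (ns k), fun k => h1 _, fun k => h2 _, fun k => h3 _, fun k => h4 _, hns⟩
end PartD
section PartF
open MeasureTheory ProbabilityTheory Matrix
open scoped ENNReal RealInnerProductSpace

variable {E : Type*} [NormedAddCommGroup E] [InnerProductSpace ℝ E] [FiniteDimensional ℝ E]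
  [MeasurableSpace E] [BorelSpace E]

theorem gh_bdd {m : ℕ} (n : Fin m → ℕ) (s : ∀ i, Fin (n i) → E) (p : Fin m → ℝ) (hp : ∀ i, 1 ≤ p i)
    (hV : ∀ v : Fin m → E, (∀ i, v i ∈ Submodule.span ℝ (Set.range (s i))) → ‖∑ i, v i‖^2 ≤ ∑ i, p i * ‖v i‖^2)
    (f : ∀ i : Fin m, (Fin (n i) → ℝ) → ℝ) (hf : ∀ i, Measurable (f i)) (K : ℝ) (hK : 0 ≤ K) (hf0 : ∀ i x, 0 ≤ f i x)
    (hfK : ∀ i x, f i x ≤ K) :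
    ∫ y, ∏ i, (f i (fun j => ⟪s i j, y⟫)) ^ (1 / p i) ∂(ProbabilityTheory.stdGaussian E) ≤
        ∏ i, (∫ y, f i (fun j => ⟪s i j, y⟫) ∂(ProbabilityTheory.stdGaussian E)) ^ (1 / p i) := by
  set γ := ProbabilityTheory.stdGaussian E with hγ
  have hp0 : ∀ i, 0 < p i := fun i => by linarith [hp i]
  have hq0 : ∀ i, 0 < 1 / p i := fun i => by have := hp0 i; positivity
  have hAm : ∀ i, Measurable (fun (y : E) (j : Fin (n i)) => ⟪s i j, y⟫) := fun i => by fun_prop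
  have hap : ∀ i, ∃ φ : ℕ → (Fin (n i) → ℝ) → ℝ, (∀ k, ContDiff ℝ 2 (φ k)) ∧ (∀ k, HasCompactSupport (φ k)) ∧
      (∀ k x, 0 ≤ φ k x) ∧ (∀ k x, φ k x ≤ K) ∧
      ∀ᵐ y ∂γ, Filter.Tendsto (fun k => φ k (fun j => ⟪s i j, y⟫)) Filter.atTop (nhds (f i (fun j => ⟪s i j, y⟫))) := by
    intro i
    obtain ⟨φ, h1, h2, h3, h4, h5⟩ := gh_approx (γ.map (fun (y : E) (j : Fin (n i)) => ⟪s i j, y⟫)) (f i) (hf i) K (hf0 i) (hfK i)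
    exact ⟨φ, h1, h2, h3, h4, ae_of_ae_map (hAm i).aemeasurable h5⟩
  choose φ h1 h2 h3 h4 h5 using hap
  let c : ℕ → ℝ := fun k => 1 / ((k : ℝ) + 1)
  have hc0 : ∀ k, 0 < c k := fun k => by simp only [c]; positivity
  have hc1 : ∀ k, c k ≤ 1 := fun k => by
    simp only [c]; rw [div_le_one (by positivity)]; linarith [(Nat.cast_nonneg k : (0:ℝ) ≤ k)]
  have hclim : Filter.Tendsto c Filter.atTop (nhds 0) := tendsto_one_div_add_atTop_nhds_zero_nat
  have hstep : ∀ k, ∫ y, ∏ i, (φ i k (fun j => ⟪s i j, y⟫) + c k) ^ (1 / p i) ∂γ ≤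
        ∏ i, (∫ y, (φ i k (fun j => ⟪s i j, y⟫) + c k) ∂γ) ^ (1 / p i) := by
    intro k
    choose L M hL hM hN using fun i => gh_nice_of_contDiff (s i) (φ i k) (h1 i k) (h2 i k) (c k) K (h3 i k) (h4 i k)
    refine gh_nice (fun i => Submodule.span ℝ (Set.range (s i))) p hp hV (c k) (K + c k) (∑ i, L i) (∑ i, M i) (hc0 k)
      (by linarith) (Finset.sum_nonneg fun i _ => hL i) (Finset.sum_nonneg fun i _ => hM i) _ fun i => ?_
    exact (hN i).mono le_rfl (Finset.single_le_sum (fun i _ => hL i) (Finset.mem_univ i))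
      (Finset.single_le_sum (fun i _ => hM i) (Finset.mem_univ i))
  have hms : ∀ i k, Measurable (fun y : E => φ i k (fun j => ⟪s i j, y⟫)) := fun i k =>
    (h1 i k).continuous.measurable.comp (hAm i)
  have hall : ∀ᵐ y ∂γ, ∀ i, Filter.Tendsto (fun k => φ i k (fun j => ⟪s i j, y⟫)) Filter.atTop (nhds (f i (fun j => ⟪s i j, y⟫))) :=
    ae_all_iff.2 h5
  have l1 : Filter.Tendsto (fun k => ∫ y, ∏ i, (φ i k (fun j => ⟪s i j, y⟫) + c k) ^ (1 / p i) ∂γ) Filter.atTop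
      (nhds (∫ y, ∏ i, (f i (fun j => ⟪s i j, y⟫)) ^ (1 / p i) ∂γ)) := by
    refine tendsto_integral_of_dominated_convergence (fun _ => ∏ i, (K + 1) ^ (1 / p i)) (fun k => ?_) (integrable_const _) (fun k => .of_forall fun y => ?_) ?_
    · exact Measurable.aestronglyMeasurable (Finset.measurable_prod _ fun i _ => ((hms i k).add_const _).pow_const _)
    · have h0 : ∀ i, 0 ≤ φ i k (fun j => ⟪s i j, y⟫) + c k := fun i => add_nonneg (h3 i k _) (hc0 k).le
      rw [Real.norm_eq_abs, abs_of_nonneg (Finset.prod_nonneg fun i _ => Real.rpow_nonneg (h0 i) _)]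
      exact Finset.prod_le_prod (fun i _ => Real.rpow_nonneg (h0 i) _) fun i _ =>
        Real.rpow_le_rpow (h0 i) (add_le_add (h4 i k _) (hc1 k)) (hq0 i).le
    · filter_upwards [hall] with y hy
      refine tendsto_finsetProd _ fun i _ => ?_
      refine Filter.Tendsto.rpow_const ?_ (Or.inr (hq0 i).le)
      simpa using (hy i).add hclim
  have l2 : Filter.Tendsto (fun k => ∏ i, (∫ y, (φ i k (fun j => ⟪s i j, y⟫) + c k) ∂γ) ^ (1 / p i)) Filter.atTop
      (nhds (∏ i, (∫ y, f i (fun j => ⟪s i j, y⟫) ∂γ) ^ (1 / p i))) := by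
    refine tendsto_finsetProd _ fun i _ => ?_
    refine Filter.Tendsto.rpow_const ?_ (Or.inr (hq0 i).le)
    refine tendsto_integral_of_dominated_convergence (fun _ => K + 1) (fun k => ?_) (integrable_const _) (fun k => .of_forall fun y => ?_) ?_
    · exact ((hms i k).add_const _).aestronglyMeasurable
    · rw [Real.norm_eq_abs, abs_of_nonneg (add_nonneg (h3 i k _) (hc0 k).le)]
      exact add_le_add (h4 i k _) (hc1 k)
    · filter_upwards [hall] with y hy
      simpa using (hy i).add hclim
  exact le_of_tendsto_of_tendsto' l1 l2 hstep

theorem gh_enn_bdd {m : ℕ} (n : Fin m → ℕ) (s : ∀ i, Fin (n i) → E) (p : Fin m → ℝ) (hp : ∀ i, 1 ≤ p i)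
    (hV : ∀ v : Fin m → E, (∀ i, v i ∈ Submodule.span ℝ (Set.range (s i))) → ‖∑ i, v i‖^2 ≤ ∑ i, p i * ‖v i‖^2)
    (f : ∀ i : Fin m, (Fin (n i) → ℝ) → ℝ) (hf : ∀ i, Measurable (f i)) (K : ℝ) (hK : 0 ≤ K) (hf0 : ∀ i x, 0 ≤ f i x)
    (hfK : ∀ i x, f i x ≤ K) :
    ∫⁻ y, ∏ i, ENNReal.ofReal (f i (fun j => ⟪s i j, y⟫)) ∂(ProbabilityTheory.stdGaussian E) ≤
        ∏ i, (∫⁻ y, ENNReal.ofReal (f i (fun j => ⟪s i j, y⟫)) ^ p i ∂(ProbabilityTheory.stdGaussian E)) ^ (1 / p i) := by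
  set γ := ProbabilityTheory.stdGaussian E with hγ
  have hp0 : ∀ i, 0 < p i := fun i => by linarith [hp i]
  have hq0 : ∀ i, 0 < 1 / p i := fun i => by have := hp0 i; positivity
  have hfm : ∀ i, Measurable (fun y : E => f i (fun j => ⟪s i j, y⟫)) := fun i => (hf i).comp (by fun_prop)
  have hpm : ∀ i x, (f i x) ^ p i ≤ ∑ i, K ^ p i := fun i x =>
    (Real.rpow_le_rpow (hf0 i x) (hfK i x) (hp0 i).le).trans
      (Finset.single_le_sum (f := fun i => K ^ p i) (fun i _ => Real.rpow_nonneg hK _) (Finset.mem_univ i))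
  have := gh_bdd n s p hp hV (fun i x => (f i x) ^ p i) (fun i => (hf i).pow_const _) (∑ i, K ^ p i)
    (Finset.sum_nonneg fun i _ => Real.rpow_nonneg hK _) (fun i x => Real.rpow_nonneg (hf0 i x) _) hpm
  have e1 : ∀ i x, ((f i x) ^ p i) ^ (1 / p i) = f i x := fun i x => by
    rw [← Real.rpow_mul (hf0 i x), mul_one_div_cancel (hp0 i).ne', Real.rpow_one]
  simp only [e1] at this
  have e2 : ∫⁻ y, ∏ i, ENNReal.ofReal (f i (fun j => ⟪s i j, y⟫)) ∂γ = ENNReal.ofReal (∫ y, ∏ i, f i (fun j => ⟪s i j, y⟫) ∂γ) := by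
    rw [ofReal_integral_eq_lintegral_ofReal]
    · refine lintegral_congr fun y => ?_
      rw [ENNReal.ofReal_prod_of_nonneg fun i _ => hf0 i _]
    · refine Integrable.of_bound (Measurable.aestronglyMeasurable (by fun_prop)) (∏ i : Fin m, K) (.of_forall fun y => ?_)
      rw [Real.norm_eq_abs, abs_of_nonneg (Finset.prod_nonneg fun i _ => hf0 i _)]
      exact Finset.prod_le_prod (fun i _ => hf0 i _) fun i _ => hfK i _
    · exact .of_forall fun y => Finset.prod_nonneg fun i _ => hf0 i _
  have e3 : ∀ i, (∫⁻ y, ENNReal.ofReal (f i (fun j => ⟪s i j, y⟫)) ^ p i ∂γ) ^ (1 / p i)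
      = ENNReal.ofReal ((∫ y, (f i (fun j => ⟪s i j, y⟫)) ^ p i ∂γ) ^ (1 / p i)) := by
    intro i
    rw [← ENNReal.ofReal_rpow_of_nonneg (integral_nonneg fun y => Real.rpow_nonneg (hf0 i _) _) (hq0 i).le,
      ofReal_integral_eq_lintegral_ofReal]
    · congr 1
      refine lintegral_congr fun y => ?_
      rw [ENNReal.ofReal_rpow_of_nonneg (hf0 i _) (hp0 i).le]
    · have := hfm i
      refine Integrable.of_bound (Measurable.aestronglyMeasurable (by fun_prop)) (∑ i, K ^ p i) (.of_forall fun y => ?_)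
      rw [Real.norm_eq_abs, abs_of_nonneg (Real.rpow_nonneg (hf0 i _) _)]
      exact hpm i _
    · exact .of_forall fun y => Real.rpow_nonneg (hf0 i _) _
  rw [e2]
  simp_rw [e3]
  rw [← ENNReal.ofReal_prod_of_nonneg fun i _ => Real.rpow_nonneg (integral_nonneg fun y => Real.rpow_nonneg (hf0 i _) _) _]
  exact ENNReal.ofReal_le_ofReal this

theorem gh_enn {m : ℕ} (n : Fin m → ℕ) (s : ∀ i, Fin (n i) → E) (p : Fin m → ℝ) (hp : ∀ i, 1 ≤ p i)
    (hV : ∀ v : Fin m → E, (∀ i, v i ∈ Submodule.span ℝ (Set.range (s i))) → ‖∑ i, v i‖^2 ≤ ∑ i, p i * ‖v i‖^2)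
    (f : ∀ i : Fin m, (Fin (n i) → ℝ) → ℝ) (hf : ∀ i, Measurable (f i)) (hf0 : ∀ i x, 0 ≤ f i x) :
    ∫⁻ y, ∏ i, ENNReal.ofReal (f i (fun j => ⟪s i j, y⟫)) ∂(ProbabilityTheory.stdGaussian E) ≤
        ∏ i, (∫⁻ y, ENNReal.ofReal (f i (fun j => ⟪s i j, y⟫)) ^ p i ∂(ProbabilityTheory.stdGaussian E)) ^ (1 / p i) := by
  set γ := ProbabilityTheory.stdGaussian E with hγ
  have hp0 : ∀ i, 0 < p i := fun i => by linarith [hp i]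
  have hq0 : ∀ i, 0 < 1 / p i := fun i => by have := hp0 i; positivity
  have hfm : ∀ i, Measurable (fun y : E => f i (fun j => ⟪s i j, y⟫)) := fun i => (hf i).comp (by fun_prop)
  have hk : ∀ k : ℕ, ∫⁻ y, ∏ i, ENNReal.ofReal (min (f i (fun j => ⟪s i j, y⟫)) (k : ℝ)) ∂γ ≤
        ∏ i, (∫⁻ y, ENNReal.ofReal (f i (fun j => ⟪s i j, y⟫)) ^ p i ∂γ) ^ (1 / p i) := by
    intro k
    refine (gh_enn_bdd n s p hp hV (fun i x => min (f i x) (k : ℝ)) (fun i => (hf i).min measurable_const) k (by positivity)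
      (fun i x => le_min (hf0 i x) (by positivity)) (fun i x => min_le_right _ _)).trans ?_
    refine Finset.prod_le_prod' fun i _ => ?_
    refine ENNReal.rpow_le_rpow (lintegral_mono fun y => ?_) (hq0 i).le
    exact ENNReal.rpow_le_rpow (ENNReal.ofReal_le_ofReal (min_le_left _ _)) (hp0 i).le
  have hlim : Filter.Tendsto (fun k : ℕ => ∫⁻ y, ∏ i, ENNReal.ofReal (min (f i (fun j => ⟪s i j, y⟫)) (k : ℝ)) ∂γ) Filter.atTop
      (nhds (∫⁻ y, ∏ i, ENNReal.ofReal (f i (fun j => ⟪s i j, y⟫)) ∂γ)) := by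
    refine lintegral_tendsto_of_tendsto_of_monotone (fun k => Measurable.aemeasurable (by fun_prop)) (.of_forall fun y => ?_) (.of_forall fun y => ?_)
    · intro k l hkl
      refine Finset.prod_le_prod' fun i _ => ENNReal.ofReal_le_ofReal (min_le_min_left _ ?_)
      exact_mod_cast hkl
    · refine tendsto_const_nhds.congr' ?_
      obtain ⟨N, hN⟩ := exists_nat_ge (∑ i, f i (fun j => ⟪s i j, y⟫))
      filter_upwards [Filter.eventually_ge_atTop N] with k hk
      refine Finset.prod_congr rfl fun i _ => ?_
      rw [min_eq_left]
      refine (Finset.single_le_sum (f := fun i => f i (fun j => ⟪s i j, y⟫)) (fun i _ => hf0 i _) (Finset.mem_univ i)).trans (hN.trans ?_)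
      exact_mod_cast hk
  exact le_of_tendsto' hlim hk
end PartF
section PartG
open MeasureTheory ProbabilityTheory Matrix
open scoped ENNReal RealInnerProductSpace

theorem gh_cov {m : ℕ} (n : Fin m → ℕ)
    (T S P : Matrix (Σ i : Fin m, Fin (n i)) (Σ i : Fin m, Fin (n i)) ℝ)
    (hTS : S * Sᵀ = T) (p : Fin m → ℝ)
    (hP : ∀ a b, P a b = if a.1 = b.1 then p a.1 * T a b else 0)
    (hTP : (P - T).PosSemidef)
    (s : (Σ i : Fin m, Fin (n i)) → EuclideanSpace ℝ (Σ i : Fin m, Fin (n i)))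
    (hs : ∀ a, s a = WithLp.toLp 2 (S a))
    (v : Fin m → EuclideanSpace ℝ (Σ i : Fin m, Fin (n i)))
    (hv : ∀ i, v i ∈ Submodule.span ℝ (Set.range (fun j => s ⟨i, j⟩))) :
    ‖∑ i, v i‖^2 ≤ ∑ i, p i * ‖v i‖^2 := by
  have hT : ∀ a b, T a b = ⟪s a, s b⟫ := by
    intro a b
    rw [← hTS, Matrix.mul_apply, hs, hs, PiLp.inner_apply]
    refine Finset.sum_congr rfl fun k _ => ?_
    simp [mul_comm]
  choose w hw using fun i => (Submodule.mem_span_range_iff_exists_fun ℝ).1 (hv i)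
  let u : (Σ i : Fin m, Fin (n i)) → ℝ := fun a => w a.1 a.2
  have h0 := hTP.dotProduct_mulVec_nonneg u
  have e1 : star u ⬝ᵥ (P - T) *ᵥ u = ∑ a, ∑ b, u a * P a b * u b - ∑ a, ∑ b, u a * T a b * u b := by
    simp only [dotProduct, mulVec, star_trivial, Matrix.sub_apply, Finset.mul_sum, ← Finset.sum_sub_distrib]
    refine Finset.sum_congr rfl fun a _ => Finset.sum_congr rfl fun b _ => by ring
  have e2 : ‖∑ i, v i‖^2 = ∑ a, ∑ b, u a * T a b * u b := by
    have : ∑ i, v i = ∑ a, u a • s a := by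
      rw [Fintype.sum_sigma]
      exact Finset.sum_congr rfl fun i _ => (hw i).symm
    rw [this, ← real_inner_self_eq_norm_sq, sum_inner]
    refine Finset.sum_congr rfl fun a _ => ?_
    rw [inner_sum]
    refine Finset.sum_congr rfl fun b _ => ?_
    rw [real_inner_smul_left, real_inner_smul_right, hT]; ring
  have e3 : ∑ i, p i * ‖v i‖^2 = ∑ a, ∑ b, u a * P a b * u b := by
    rw [Fintype.sum_sigma]
    refine Finset.sum_congr rfl fun i _ => ?_
    rw [← real_inner_self_eq_norm_sq, ← hw i, sum_inner, Finset.mul_sum]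
    refine Finset.sum_congr rfl fun j _ => ?_
    rw [inner_sum, Finset.mul_sum, Fintype.sum_sigma, Finset.sum_eq_single i]
    · refine Finset.sum_congr rfl fun k _ => ?_
      rw [real_inner_smul_left, real_inner_smul_right, hP, ← hT]
      simp [u]; ring
    · intro i' _ hi'
      refine Finset.sum_eq_zero fun k _ => ?_
      rw [hP, if_neg (fun h => hi' h.symm)]; simp
    · simp
  rw [e1, ← e2, ← e3] at h0
  linarith

theorem gh_degenerate {m : ℕ} (n : Fin m → ℕ)
    (T S P : Matrix (Σ i : Fin m, Fin (n i)) (Σ i : Fin m, Fin (n i)) ℝ)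
    (hTS : S * Sᵀ = T) (p : Fin m → ℝ)
    (hP : ∀ a b, P a b = if a.1 = b.1 then p a.1 * T a b else 0)
    (hTP : (P - T).PosSemidef) (a : Σ i : Fin m, Fin (n i)) (ha : p a.1 < 1) : S a = 0 := by
  have h1 : 0 ≤ (P - T) a a := hTP.diag_nonneg
  have h2 : T a a = ∑ k, S a k ^ 2 := by
    rw [← hTS, Matrix.mul_apply]
    exact Finset.sum_congr rfl fun k _ => by simp [sq]
  rw [Matrix.sub_apply, hP, if_pos rfl] at h1
  have h3 : 0 ≤ ∑ k, S a k ^ 2 := Finset.sum_nonneg fun k _ => sq_nonneg _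
  have h4 : ∑ k, S a k ^ 2 = 0 := by nlinarith
  rw [Finset.sum_eq_zero_iff_of_nonneg fun k _ => sq_nonneg _] at h4
  ext k
  simpa using h4 k (Finset.mem_univ k)

theorem gh_pMean_const {Ω : Type*} [MeasurableSpace Ω] (μ : Measure Ω) [IsProbabilityMeasure μ]
    (g : Ω → ℝ≥0∞) (c : ℝ) (hc : 0 ≤ c) (hg : ∀ᵐ ω ∂μ, g ω = ENNReal.ofReal c) (p : ℝ) :
    ENNReal.ofReal c ≤ pMeanE μ g p := by
  unfold pMeanE
  split_ifs with h
  · have : ∫ x, Real.log (g x).toReal ∂μ = Real.log c := by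
      rw [integral_congr_ae (g := fun _ => Real.log c)]
      · simp
      · filter_upwards [hg] with ω hω
        rw [hω, ENNReal.toReal_ofReal hc]
    rw [this]
    refine ENNReal.ofReal_le_ofReal ?_
    rcases hc.eq_or_lt with h0 | h0
    · rw [← h0]; positivity
    · rw [Real.exp_log h0]
  · have : ∫⁻ x, g x ^ p ∂μ = ENNReal.ofReal c ^ p := by
      rw [lintegral_congr_ae (g := fun _ => ENNReal.ofReal c ^ p)]
      · simp
      · filter_upwards [hg] with ω hω
        rw [hω]
    rw [this, ← ENNReal.rpow_mul, mul_one_div_cancel h, ENNReal.rpow_one]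
end PartG

theorem stmt0
    {Ω : Type*} [MeasurableSpace Ω] (μ : Measure Ω) [IsProbabilityMeasure μ]
    (m : ℕ) (hm : 0 < m) (n : Fin m → ℕ) (hn : ∀ i, 0 < n i)
    (X : Ω → ((Σ i : Fin m, Fin (n i)) → ℝ)) (hX : Measurable X)
    (T S : Matrix (Σ i : Fin m, Fin (n i)) (Σ i : Fin m, Fin (n i)) ℝ)
    (hTS : S * Sᵀ = T)
    (hlaw : Measure.map X μ = Measure.map S.mulVec (stdGaussian (Σ i : Fin m, Fin (n i))))
    (p : Fin m → ℝ)
    (P : Matrix (Σ i : Fin m, Fin (n i)) (Σ i : Fin m, Fin (n i)) ℝ)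
    (hP : ∀ a b, P a b = if a.1 = b.1 then p a.1 * T a b else 0)
    (hTP : (P - T).PosSemidef)
    (f : ∀ i : Fin m, (Fin (n i) → ℝ) → ℝ)
    (hmeas : ∀ i, Measurable (f i)) (hpos : ∀ i x, 0 ≤ f i x) :
    ∫⁻ ω, ∏ i, ENNReal.ofReal (f i (fun j => X ω ⟨i, j⟩)) ∂μ
      ≤ ∏ i, pMeanE μ (fun ω => ENNReal.ofReal (f i (fun j => X ω ⟨i, j⟩))) (p i) := by
  set s : (Σ i : Fin m, Fin (n i)) → EuclideanSpace ℝ (Σ i : Fin m, Fin (n i)) :=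
    fun a => WithLp.toLp 2 (S a) with hs
  set γ := ProbabilityTheory.stdGaussian (EuclideanSpace ℝ (Σ i : Fin m, Fin (n i))) with hγ
  have hAm : Measurable (fun (y : EuclideanSpace ℝ (Σ i : Fin m, Fin (n i)))
      (a : Σ i : Fin m, Fin (n i)) => inner ℝ (s a) y) := by fun_prop
  have hmap : μ.map X = γ.map (fun y a => inner ℝ (s a) y) := by
    rw [hlaw, hγ, ← map_pi_eq_stdGaussian, Measure.map_map hAm (by fun_prop)]
    congr 1
    ext z a
    simp only [Function.comp, hs, Matrix.mulVec, PiLp.inner_apply, dotProduct]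
    refine Finset.sum_congr rfl fun k _ => ?_
    simp [mul_comm]
  have htr : ∀ Φ : ((Σ i : Fin m, Fin (n i)) → ℝ) → ℝ≥0∞, Measurable Φ →
      ∫⁻ ω, Φ (X ω) ∂μ = ∫⁻ y, Φ (fun a => inner ℝ (s a) y) ∂γ := by
    intro Φ hΦ
    rw [← lintegral_map hΦ hX, hmap, lintegral_map hΦ hAm]
  have hfm : ∀ i, Measurable (fun x : (Σ i : Fin m, Fin (n i)) → ℝ => f i (fun j => x ⟨i, j⟩)) :=
    fun i => (hmeas i).comp (by fun_prop)
  rw [htr (fun x => ∏ i, ENNReal.ofReal (f i (fun j => x ⟨i, j⟩))) (by fun_prop)]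
  have hV : ∀ v : Fin m → EuclideanSpace ℝ (Σ i : Fin m, Fin (n i)),
      (∀ i, v i ∈ Submodule.span ℝ (Set.range (fun j => s ⟨i, j⟩))) →
      ‖∑ i, v i‖^2 ≤ ∑ i, max (p i) 1 * ‖v i‖^2 := by
    intro v hv
    refine (gh_cov n T S P hTS p hP hTP s (fun a => rfl) v hv).trans ?_
    exact Finset.sum_le_sum fun i _ => mul_le_mul_of_nonneg_right (le_max_left _ _) (by positivity)
  refine (gh_enn n (fun i j => s ⟨i, j⟩) (fun i => max (p i) 1) (fun i => le_max_right _ _) hV f hmeas hpos).trans ?_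
  refine Finset.prod_le_prod' fun i _ => ?_
  rcases le_or_gt 1 (p i) with h | h
  · rw [max_eq_left h]
    have hp0 : p i ≠ 0 := by linarith
    unfold pMeanE
    rw [if_neg hp0]
    have := hfm i
    rw [htr (fun x => ENNReal.ofReal (f i (fun j => x ⟨i, j⟩)) ^ p i) (by fun_prop)]
  · have hz : ∀ j, s ⟨i, j⟩ = 0 := by
      intro j
      simp only [hs]
      rw [gh_degenerate n T S P hTS p hP hTP ⟨i, j⟩ h]
      rfl
    rw [max_eq_right h.le]
    simp only [hz, inner_zero_left, ENNReal.rpow_one, div_one, lintegral_const, measure_univ, mul_one]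
    refine gh_pMean_const μ _ _ (hpos i _) ?_ _
    have hae : ∀ᵐ ω ∂μ, ∀ j : Fin (n i), X ω ⟨i, j⟩ = 0 := by
      have : ∀ᵐ x ∂(μ.map X), ∀ j : Fin (n i), x ⟨i, j⟩ = 0 := by
        rw [hmap, ae_map_iff hAm.aemeasurable]
        · refine .of_forall fun y j => ?_
          show inner ℝ (s ⟨i, j⟩) y = 0; rw [hz, inner_zero_left]
        · rw [Set.setOf_forall]
          exact MeasurableSet.iInter fun j => measurableSet_eq_fun (by fun_prop) measurable_const
      exact ae_of_ae_map hX.aemeasurable this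
    filter_upwards [hae] with ω hω
    simp only [hω]
end

section
/- Let m ≥ n and n₁,…,n_m ≤ n be positive integers with N = n₁+⋯+n_m. For each 1 ≤ i ≤ m, let Uᵢ be an nᵢ×n real matrix with UᵢUᵢ* = I_{nᵢ}, let U be the N×n matrix with block rows U₁,…,U_m, and let D = diag(d₁I_{n₁},…,d_mI_{n_m}) with nonzero real entries dᵢ. If UU* ≤ D⁻¹ (i.e. D⁻¹ − UU* is positive semidefinite), then for all nonnegative Lebesgue measurable functions fᵢ on ℝ^{nᵢ}, ∫_{ℝⁿ} ∏_{i=1}^m fᵢ(Uᵢx) dγₙ(x) ≤ ∏_{i=1}^m (∫_{ℝ^{nᵢ}} fᵢ(xᵢ)^{1/dᵢ} dγ_{nᵢ}(xᵢ))^{dᵢ}. -/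
open MeasureTheory ProbabilityTheory Matrix
open scoped ENNReal

namespace BLproof

noncomputable abbrev gam (ι : Type*) [Fintype ι] : Measure (ι → ℝ) := _root_.stdGaussian ι

instance gam_prob (ι : Type*) [Fintype ι] : IsProbabilityMeasure (gam ι) := by
  unfold gam _root_.stdGaussian; infer_instance

instance gam_gauss (ι : Type*) [Fintype ι] : IsGaussian (gam ι) := by
  have h := map_pi_eq_stdGaussian (ι := ι)
  have h2 : IsGaussian ((gam ι).map (PiLp.continuousLinearEquiv 2 ℝ (fun _ : ι => ℝ)).symm) := by
    have e : (gam ι).map (PiLp.continuousLinearEquiv 2 ℝ (fun _ : ι => ℝ)).symm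
      = ProbabilityTheory.stdGaussian (EuclideanSpace ℝ ι) := h
    rw [e]; infer_instance
  exact (isGaussian_map_equiv_iff _).1 h2

lemma dual_eq {ι : Type*} [Fintype ι] [DecidableEq ι] (L : StrongDual ℝ (ι → ℝ)) (x : ι → ℝ) :
    L x = ∑ i, L (Pi.single i 1) * x i := by
  have := LinearMap.pi_apply_eq_sum_univ (L : (ι → ℝ) →ₗ[ℝ] ℝ) x
  simp only [ContinuousLinearMap.coe_coe, smul_eq_mul] at this
  rw [this]
  refine Finset.sum_congr rfl fun i _ => ?_
  rw [mul_comm]; congr 2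
  ext j; simp [Pi.single_apply, eq_comm]

lemma gam_integral_dual {ι : Type*} [Fintype ι] (L : StrongDual ℝ (ι → ℝ)) :
    ∫ x, L x ∂(gam ι) = 0 := by
  classical
  rw [integral_congr_ae (Filter.Eventually.of_forall (dual_eq L))]
  rw [integral_finsetSum]
  · refine Finset.sum_eq_zero fun i _ => ?_
    rw [integral_const_mul]
    have := (measurePreserving_eval (fun _ : ι => gaussianReal 0 1) i).map_eq
    have h2 : ∫ x, x i ∂(gam ι) = ∫ y, y ∂(gaussianReal 0 1) := by
      rw [← this, integral_map (measurable_pi_apply i).aemeasurable (by fun_prop)]; rfl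
    rw [h2]; simp
  · intro i _
    exact (IsGaussian.integrable_dual (gam ι) (ContinuousLinearMap.proj (R := ℝ) i)).const_mul _

lemma gam_var {ι : Type*} [Fintype ι] [DecidableEq ι] (L : StrongDual ℝ (ι → ℝ)) :
    Var[L; gam ι] = ∑ i, (L (Pi.single i 1)) ^ 2 := by
  have : (L : (ι → ℝ) → ℝ) = ∑ i, (fun x : ι → ℝ => L (Pi.single i 1) * x i) := by
    ext x; rw [dual_eq L x]; simp
  conv_lhs => rw [this]
  unfold gam _root_.stdGaussian
  rw [variance_sum_pi]
  · change ∑ i, Var[fun x ↦ _ * (id x); gaussianReal 0 1] = _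
    simp_rw [variance_const_mul, variance_id_gaussianReal]
    simp
  · exact fun i ↦ IsGaussian.memLp_two_id.const_mul _

lemma gam_sq {ι : Type*} [Fintype ι] [DecidableEq ι] (L : StrongDual ℝ (ι → ℝ)) :
    ∫ x, (L x) ^ 2 ∂(gam ι) = ∑ i, (L (Pi.single i 1)) ^ 2 := by
  rw [← gam_var, variance_of_integral_eq_zero (by fun_prop) (gam_integral_dual L)]

lemma gam_charFunDual {ι : Type*} [Fintype ι] [DecidableEq ι] (L : StrongDual ℝ (ι → ℝ)) :
    charFunDual (gam ι) L = Complex.exp (- ((∑ i, (L (Pi.single i 1)) ^ 2 : ℝ) : ℂ) / 2) := by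
  rw [IsGaussian.charFunDual_eq, gam_var]
  rw [integral_complex_ofReal, gam_integral_dual]
  simp [neg_div]

lemma gam_map {p q : ℕ} (A : Matrix (Fin p) (Fin q) ℝ) (hA : A * Aᵀ = 1) :
    (gam (Fin q)).map (fun x => A.mulVec x) = gam (Fin p) := by
  apply Measure.ext_of_charFunDual
  ext L
  have e : (fun x => A.mulVec x) = ((LinearMap.toContinuousLinearMap A.mulVecLin : (Fin q → ℝ) →L[ℝ] (Fin p → ℝ)) : (Fin q → ℝ) → (Fin p → ℝ)) := by
    ext x; simp
  rw [e, charFunDual_map, gam_charFunDual, gam_charFunDual]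
  congr 4
  have h1 : ∀ k, L (A.mulVec (Pi.single k 1)) = ∑ i, L (Pi.single i 1) * A i k := by
    intro k; rw [dual_eq L]; simp
  simp only [ContinuousLinearMap.comp_apply, LinearMap.coe_toContinuousLinearMap', Matrix.mulVecLin_apply, h1]
  set w : Fin p → ℝ := fun i => L (Pi.single i 1)
  have h2 : ∑ k, (∑ i, w i * A i k)^2 = (w ᵥ* A) ⬝ᵥ (w ᵥ* A) := by
    simp [dotProduct, Matrix.vecMul, sq]
  have h3 : ∑ i, w i ^ 2 = w ⬝ᵥ w := by simp [dotProduct, sq]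
  change ∑ k, (∑ i, w i * A i k)^2 = ∑ i, w i ^ 2
  rw [h2, h3, ← Matrix.dotProduct_mulVec]
  rw [← Matrix.mulVec_transpose, Matrix.mulVec_mulVec, hA, Matrix.one_mulVec]

lemma gam_semi {ι : Type*} [Fintype ι] {a b c : ℝ} (h : a ^ 2 + b ^ 2 = c ^ 2) :
    ((gam ι).prod (gam ι)).map (fun p => a • p.1 + b • p.2) = (gam ι).map (fun x => c • x) := by
  classical
  apply Measure.ext_of_charFunDual
  ext L
  have e1 : (fun x : ι → ℝ => c • x) = ((c • ContinuousLinearMap.id ℝ (ι → ℝ) : (ι → ℝ) →L[ℝ] (ι → ℝ)) : (ι → ℝ) → (ι → ℝ)) := by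
    ext x; simp
  have e2 : (fun p : (ι → ℝ) × (ι → ℝ) => a • p.1 + b • p.2) = ((a • ContinuousLinearMap.fst ℝ (ι → ℝ) (ι → ℝ) + b • ContinuousLinearMap.snd ℝ (ι → ℝ) (ι → ℝ) : (ι → ℝ) × (ι → ℝ) →L[ℝ] (ι → ℝ)) : (ι → ℝ) × (ι → ℝ) → (ι → ℝ)) := by
    ext x; simp
  rw [e1, e2, charFunDual_map, charFunDual_map, charFunDual_prod, gam_charFunDual, gam_charFunDual, gam_charFunDual,
    ← Complex.exp_add]
  congr 1
  rw [← add_div, ← neg_add, ← Complex.ofReal_add]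
  congr 3
  simp only [ContinuousLinearMap.comp_apply, ContinuousLinearMap.inl_apply, ContinuousLinearMap.inr_apply,
    _root_.add_apply, _root_.smul_apply, ContinuousLinearMap.coe_fst', ContinuousLinearMap.coe_snd',
    ContinuousLinearMap.id_apply, map_smul, smul_zero, add_zero, zero_add, smul_eq_mul, mul_pow]
  rw [← Finset.mul_sum, ← Finset.mul_sum, ← Finset.mul_sum, ← h, add_mul]

end BLproof

namespace BLproof

lemma log_le_cubic {x : ℝ} (hx : -1 < x) : Real.log (1 + x) ≤ x - x ^ 2 / 2 + |x| ^ 3 / 3 := by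
  have key : ∀ y : ℝ, -1 < y → 
      HasDerivAt (fun y : ℝ => y - y ^ 2 / 2 + y ^ 3 / 3 - Real.log (1 + y)) (y ^ 3 / (1 + y)) y := by
    intro y hy
    have h1 : (1 + y) ≠ 0 := by linarith
    have := (((hasDerivAt_id y).sub (((hasDerivAt_id y).pow 2).div_const 2)).add
      (((hasDerivAt_id y).pow 3).div_const 3)).sub (((hasDerivAt_id y).const_add 1).log h1)
    convert! this using 1
    simp only [id]
    field_simp
    push_cast
    ring
  have h0 : 0 ≤ (fun y : ℝ => y - y ^ 2 / 2 + y ^ 3 / 3 - Real.log (1 + y)) x := by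
    have e0 : (fun y : ℝ => y - y ^ 2 / 2 + y ^ 3 / 3 - Real.log (1 + y)) 0 = 0 := by simp
    rcases le_total 0 x with h | h
    · have hm : MonotoneOn (fun y : ℝ => y - y ^ 2 / 2 + y ^ 3 / 3 - Real.log (1 + y)) (Set.Icc 0 x) := by
        apply monotoneOn_of_deriv_nonneg (convex_Icc _ _)
        · intro y hy
          exact (key y (by linarith [hy.1])).continuousAt.continuousWithinAt
        · intro y hy
          rw [interior_Icc] at hy
          exact (key y (by linarith [hy.1])).differentiableAt.differentiableWithinAt
        · intro y hy
          rw [interior_Icc] at hy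
          rw [(key y (by linarith [hy.1])).deriv]
          have := hy.1
          positivity
      rw [← e0]
      exact hm ⟨le_refl _, h⟩ ⟨h, le_refl _⟩ h
    · have hm : AntitoneOn (fun y : ℝ => y - y ^ 2 / 2 + y ^ 3 / 3 - Real.log (1 + y)) (Set.Icc x 0) := by
        apply antitoneOn_of_deriv_nonpos (convex_Icc _ _)
        · intro y hy
          exact (key y (by linarith [hy.1])).continuousAt.continuousWithinAt
        · intro y hy
          rw [interior_Icc] at hy
          exact (key y (by linarith [hy.1])).differentiableAt.differentiableWithinAt
        · intro y hy
          rw [interior_Icc] at hy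
          rw [(key y (by linarith [hy.1])).deriv]
          apply div_nonpos_of_nonpos_of_nonneg
          · exact (Odd.pow_nonpos (by decide) hy.2.le)
          · linarith [hy.1]
      rw [← e0]
      exact hm ⟨le_refl _, h⟩ ⟨h, le_refl _⟩ h
  have h1 : x ^ 3 ≤ |x| ^ 3 := by
    rw [← abs_pow]; exact le_abs_self _
  simp only at h0
  linarith

lemma exp_le_cubic {s B : ℝ} (h : |s| ≤ B) : Real.exp s ≤ 1 + s + s ^ 2 / 2 + Real.exp B * |s| ^ 3 := by
  have := Complex.norm_exp_sub_sum_le_norm_mul_exp (s : ℂ) 3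
  have e : Complex.exp (s : ℂ) - ∑ m ∈ Finset.range 3, (s : ℂ) ^ m / (m.factorial : ℂ)
      = ((Real.exp s - (1 + s + s ^ 2 / 2) : ℝ) : ℂ) := by
    simp only [Finset.sum_range_succ, Finset.sum_range_zero]
    push_cast
    norm_num
  rw [e, Complex.norm_real, Complex.norm_real, Real.norm_eq_abs, Real.norm_eq_abs] at this
  have h1 := (abs_le.1 this).2
  have h2 : |s| ^ 3 * Real.exp |s| ≤ |s| ^ 3 * Real.exp B := by gcongr
  nlinarith

lemma wsum_abs_le {m : ℕ} {d : Fin m → ℝ} (hd0 : ∀ i, 0 < d i) {x : Fin m → ℝ} {M : ℝ}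
    (h : ∀ i, |x i| ≤ M) : |∑ i, d i * x i| ≤ (∑ i, d i) * M := by
  refine (Finset.abs_sum_le_sum_abs _ _).trans ?_
  rw [Finset.sum_mul]
  refine Finset.sum_le_sum fun i _ => ?_
  rw [abs_mul, abs_of_pos (hd0 i)]
  exact mul_le_mul_of_nonneg_left (h i) (hd0 i).le

lemma pointwise {m : ℕ} (d : Fin m → ℝ) (hd0 : ∀ i, 0 < d i) (B K1 K2 : ℝ) (hB : 0 ≤ B)
    (hK1 : 0 ≤ K1) (hK2 : 0 ≤ K2) :
    ∃ K : ℝ, 0 ≤ K ∧ ∀ t : ℝ, 0 ≤ t → ∀ ξ l : Fin m → ℝ, (∀ i, -1 < ξ i) → (∀ i, |ξ i| ≤ B) →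
      (∀ i, |l i| ≤ K2 * t) → (∀ i, |ξ i - l i| ≤ K1 * t ^ 2) →
      ∏ i, (1 + ξ i) ^ (d i) ≤ 1 + ∑ i, d i * ξ i
        + ((∑ i, d i * l i) ^ 2 - ∑ i, d i * (l i) ^ 2) / 2 + K * t ^ 3 := by
  obtain ⟨D, hD⟩ : ∃ D, D = ∑ i, d i := ⟨_, rfl⟩
  have hD0 : 0 ≤ D := by rw [hD]; exact Finset.sum_nonneg fun i _ => (hd0 i).le
  have hw : ∀ (x : Fin m → ℝ) (M : ℝ), (∀ i, |x i| ≤ M) → |∑ i, d i * x i| ≤ D * M := by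
    intro x M h; rw [hD]; exact wsum_abs_le hd0 h
  obtain ⟨K3, hK3⟩ : ∃ K3, K3 = B + K1 + K2 := ⟨_, rfl⟩
  have hK30 : 0 ≤ K3 := by rw [hK3]; positivity
  obtain ⟨K6, hK6⟩ : ∃ K6, K6 = D * (K3 ^ 2) * (1 + B) := ⟨_, rfl⟩
  have hK60 : 0 ≤ K6 := by rw [hK6]; positivity
  obtain ⟨K7, hK7⟩ : ∃ K7, K7 = D * K3 * B + D * K3 * B ^ 2 := ⟨_, rfl⟩
  have hK70 : 0 ≤ K7 := by rw [hK7]; positivity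
  obtain ⟨B5, hB5⟩ : ∃ B5, B5 = D * B + D * B ^ 2 + D * B ^ 3 := ⟨_, rfl⟩
  refine ⟨Real.exp B5 * (D * K3 + K7) ^ 3 + D * K3 * K6 + K6 * K7 / 2 + D * K3 ^ 3 / 3 + (D * K1) * (D * K3 + D * K2)
    + D * (K1 * (K3 + K2)), by positivity, ?_⟩
  intro t ht ξ l hξ1 hξB hl hr
  have hξ3 : ∀ i, |ξ i| ≤ K3 * t := by
    intro i
    rcases le_total t 1 with h | h
    · have h1 : |ξ i| ≤ |ξ i - l i| + |l i| := by
        have := abs_add_le (ξ i - l i) (l i); simpa using this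
      have h2 : K1 * t ^ 2 ≤ K1 * t := by
        apply mul_le_mul_of_nonneg_left _ hK1; nlinarith
      have h3 : 0 ≤ B * t := by positivity
      have := hl i; have := hr i
      rw [hK3]; nlinarith
    · refine (hξB i).trans ?_
      rw [hK3]
      have : 0 ≤ (K1 + K2) * t := by positivity
      nlinarith
  obtain ⟨a, ha⟩ : ∃ a, a = ∑ i, d i * ξ i := ⟨_, rfl⟩
  obtain ⟨q, hq⟩ : ∃ q, q = ∑ i, d i * (ξ i) ^ 2 := ⟨_, rfl⟩
  obtain ⟨c, hc⟩ : ∃ c, c = ∑ i, d i * (|ξ i| ^ 3 / 3) := ⟨_, rfl⟩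
  obtain ⟨a0, ha0⟩ : ∃ a0, a0 = ∑ i, d i * l i := ⟨_, rfl⟩
  obtain ⟨q0, hq0⟩ : ∃ q0, q0 = ∑ i, d i * (l i) ^ 2 := ⟨_, rfl⟩
  obtain ⟨e, he⟩ : ∃ e, e = - q / 2 + c := ⟨_, rfl⟩
  have hprod : ∏ i, (1 + ξ i) ^ (d i) ≤ Real.exp (a + e) := by
    have : ∏ i, (1 + ξ i) ^ (d i) = Real.exp (∑ i, d i * Real.log (1 + ξ i)) := by
      rw [Real.exp_sum]
      refine Finset.prod_congr rfl fun i _ => ?_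
      rw [Real.rpow_def_of_pos (by linarith [hξ1 i]), mul_comm]
    rw [this]
    apply Real.exp_le_exp.2
    have e2 : a + e = ∑ i, d i * (ξ i - (ξ i) ^ 2 / 2 + |ξ i| ^ 3 / 3) := by
      rw [he, ha, hq, hc, neg_div, Finset.sum_div, ← Finset.sum_neg_distrib, ← Finset.sum_add_distrib,
        ← Finset.sum_add_distrib]
      refine Finset.sum_congr rfl fun i _ => ?_
      ring
    rw [e2]
    exact Finset.sum_le_sum fun i _ => mul_le_mul_of_nonneg_left (log_le_cubic (hξ1 i)) (hd0 i).le
  -- bounds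
  have ba : |a| ≤ D * (K3 * t) := by rw [ha]; exact hw _ _ hξ3
  have ba' : |a| ≤ D * B := by rw [ha]; exact hw _ _ hξB
  have hee : e = ∑ i, d i * (- (ξ i) ^ 2 / 2 + |ξ i| ^ 3 / 3) := by
    rw [he, hq, hc, neg_div, Finset.sum_div, ← Finset.sum_neg_distrib, ← Finset.sum_add_distrib]
    refine Finset.sum_congr rfl fun i _ => ?_
    ring
  have he0 : ∀ i, |- (ξ i) ^ 2 / 2 + |ξ i| ^ 3 / 3| ≤ |ξ i| ^ 2 * (1 + |ξ i|) := by
    intro i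
    have h0 := abs_nonneg (ξ i)
    have : (ξ i) ^ 2 = |ξ i| ^ 2 := (sq_abs _).symm
    rw [this, abs_le]
    have h3 : 0 ≤ |ξ i| ^ 3 := by positivity
    have h2 : 0 ≤ |ξ i| ^ 2 := by positivity
    constructor <;> nlinarith
  have be : |e| ≤ K6 * t ^ 2 := by
    rw [hee]
    have : K6 * t ^ 2 = D * ((K3 * t) ^ 2 * (1 + B)) := by rw [hK6]; ring
    rw [this]
    refine hw _ _ fun i => (he0 i).trans ?_
    have := hξ3 i; have := hξB i
    gcongr
  have be1 : |e| ≤ K7 * t := by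
    rw [hee]
    have : K7 * t = D * ((K3 * t) * (B * (1 + B))) := by rw [hK7]; ring
    rw [this]
    refine hw _ _ fun i => (he0 i).trans ?_
    have := hξ3 i; have := hξB i
    rw [sq, mul_assoc]
    gcongr
  have be2 : |e| ≤ D * B ^ 2 + D * B ^ 3 := by
    rw [hee]
    have : D * B ^ 2 + D * B ^ 3 = D * (B ^ 2 * (1 + B)) := by ring
    rw [this]
    refine hw _ _ fun i => (he0 i).trans ?_
    have := hξB i
    gcongr
  have bs : |a + e| ≤ (D * K3 + K7) * t := by
    refine (abs_add_le _ _).trans ?_; linarith [show D * (K3 * t) + K7 * t = (D * K3 + K7) * t by ring]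
  have bs' : |a + e| ≤ B5 := by
    refine (abs_add_le _ _).trans ?_; rw [hB5]; linarith
  have hexp := exp_le_cubic bs'
  have h3 : Real.exp B5 * |a + e| ^ 3 ≤ Real.exp B5 * ((D * K3 + K7) * t) ^ 3 := by gcongr
  have hae : a * e ≤ (D * (K3 * t)) * (K6 * t ^ 2) := by
    refine (le_abs_self _).trans ?_
    rw [abs_mul]; gcongr
  have hee2 : e * e ≤ (K6 * t ^ 2) * (K7 * t) := by
    refine (le_abs_self _).trans ?_
    rw [abs_mul]; gcongr
  have hce : c ≤ e + q / 2 := by rw [he]; linarith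
  have hc3 : e ≤ - q / 2 + D * (K3 ^ 3) * t ^ 3 / 3 := by
    have : |c| ≤ D * ((K3 * t) ^ 3 / 3) := by
      rw [hc]
      refine hw _ _ fun i => ?_
      rw [abs_of_nonneg (by positivity)]
      have := hξ3 i
      gcongr
    have := (abs_le.1 this).2
    rw [he]; linarith [show D * ((K3 * t) ^ 3 / 3) = D * (K3 ^ 3) * t ^ 3 / 3 by ring]
  have hδ : |a - a0| ≤ D * (K1 * t ^ 2) := by
    have : a - a0 = ∑ i, d i * (ξ i - l i) := by
      rw [ha, ha0, ← Finset.sum_sub_distrib]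
      exact Finset.sum_congr rfl fun i _ => by ring
    rw [this]; exact hw _ _ hr
  have ba0 : |a0| ≤ D * (K2 * t) := by rw [ha0]; exact hw _ _ hl
  have haa : a ^ 2 - a0 ^ 2 ≤ (D * (K1 * t ^ 2)) * (D * (K3 * t) + D * (K2 * t)) := by
    have : a ^ 2 - a0 ^ 2 = (a - a0) * (a + a0) := by ring
    rw [this]
    refine (le_abs_self _).trans ?_
    rw [abs_mul]
    have := abs_add_le a a0
    gcongr
    linarith
  have hqq : |q - q0| ≤ D * ((K1 * t ^ 2) * (K3 * t + K2 * t)) := by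
    have : q - q0 = ∑ i, d i * ((ξ i - l i) * (ξ i + l i)) := by
      rw [hq, hq0, ← Finset.sum_sub_distrib]
      exact Finset.sum_congr rfl fun i _ => by ring
    rw [this]
    refine hw _ _ fun i => ?_
    rw [abs_mul]
    have := abs_add_le (ξ i) (l i)
    have := hr i; have := hξ3 i; have := hl i
    gcongr
    linarith
  have hqq' := (abs_le.1 hqq).1
  rw [← ha, ← ha0, ← hq0]
  refine hprod.trans (hexp.trans ?_)
  have p1 : 0 ≤ (D * (K1 * t ^ 2)) * (D * (K3 * t) + D * (K2 * t)) := by positivity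
  have p2 : 0 ≤ D * ((K1 * t ^ 2) * (K3 * t + K2 * t)) := by positivity
  have hfin : (Real.exp B5 * (D * K3 + K7) ^ 3 + D * K3 * K6 + K6 * K7 / 2 + D * K3 ^ 3 / 3
    + (D * K1) * (D * K3 + D * K2) + D * (K1 * (K3 + K2))) * t ^ 3
    = Real.exp B5 * ((D * K3 + K7) * t) ^ 3 + (D * (K3 * t)) * (K6 * t ^ 2) +
      (K6 * t ^ 2) * (K7 * t) / 2 + D * (K3 ^ 3) * t ^ 3 / 3
      + (D * (K1 * t ^ 2)) * (D * (K3 * t) + D * (K2 * t)) +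
      D * ((K1 * t ^ 2) * (K3 * t + K2 * t)) := by ring
  rw [hfin]
  have hsq : (a + e) ^ 2 = a ^ 2 + 2 * (a * e) + e * e := by ring
  rw [hsq]
  linarith

end BLproof

namespace BLproof

/-- Heat average. -/
noncomputable def heat {p : ℕ} (s : ℝ) (f : (Fin p → ℝ) → ℝ) (x : Fin p → ℝ) : ℝ :=
  ∫ z, f (x + s • z) ∂(gam (Fin p))

structure Reg {p : ℕ} (c b L K : ℝ) (f : (Fin p → ℝ) → ℝ)
    (g : (Fin p → ℝ) → StrongDual ℝ (Fin p → ℝ)) : Prop where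
  cf : Continuous f
  cg : Continuous g
  lo : ∀ x, c ≤ f x
  hi : ∀ x, f x ≤ b
  gb : ∀ x, ‖g x‖ ≤ L
  ta : ∀ x h, |f (x + h) - f x - g x h| ≤ K * ‖h‖ ^ 2

lemma integrable_of_bdd {p : ℕ} {E : Type*} [NormedAddCommGroup E] [NormedSpace ℝ E]
    [SecondCountableTopology E] [MeasurableSpace E] [BorelSpace E]
    {F : (Fin p → ℝ) → E} (hF : Continuous F) {C : ℝ} (hC : ∀ x, ‖F x‖ ≤ C) :
    Integrable F (gam (Fin p)) :=
  Integrable.of_bound hF.aestronglyMeasurable C (Filter.Eventually.of_forall hC)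

lemma Reg.abs_le {p : ℕ} {c b L K : ℝ} {f : (Fin p → ℝ) → ℝ}
    {g : (Fin p → ℝ) → StrongDual ℝ (Fin p → ℝ)} (h : Reg c b L K f g) (hc : 0 < c) (x) :
    ‖f x‖ ≤ b := by
  rw [Real.norm_eq_abs, _root_.abs_le]
  have := h.lo x; have := h.hi x
  constructor <;> linarith

lemma Reg.heat {p : ℕ} {c b L K : ℝ} {f : (Fin p → ℝ) → ℝ}
    {g : (Fin p → ℝ) → StrongDual ℝ (Fin p → ℝ)} (h : Reg c b L K f g) (hc : 0 < c) (s : ℝ) :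
    Reg c b L K (heat s f) (fun x => ∫ z, g (x + s • z) ∂(gam (Fin p))) := by
  have If : ∀ x, Integrable (fun z => f (x + s • z)) (gam (Fin p)) := fun x =>
    integrable_of_bdd (h.cf.comp (by fun_prop)) (fun z => h.abs_le hc _)
  have Ig : ∀ x, Integrable (fun z => g (x + s • z)) (gam (Fin p)) := fun x =>
    Integrable.of_bound (h.cg.comp (by fun_prop)).aestronglyMeasurable L
      (Filter.Eventually.of_forall fun z => h.gb _)
  refine ⟨?_, ?_, ?_, ?_, ?_, ?_⟩
  · refine continuous_of_dominated (bound := fun _ => b) (fun x => (If x).aestronglyMeasurable)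
      (fun x => Filter.Eventually.of_forall fun z => h.abs_le hc _) (integrable_const _)
      (Filter.Eventually.of_forall fun z => h.cf.comp (by fun_prop))
  · refine continuous_of_dominated (bound := fun _ => L) (fun x => (Ig x).aestronglyMeasurable)
      (fun x => Filter.Eventually.of_forall fun z => h.gb _) (integrable_const _)
      (Filter.Eventually.of_forall fun z => h.cg.comp (by fun_prop))
  · intro x
    have := integral_mono (integrable_const c) (If x) (fun z => h.lo _)
    simpa [BLproof.heat] using this
  · intro x
    have := integral_mono (If x) (integrable_const b) (fun z => h.hi _)
    simpa [BLproof.heat] using this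
  · intro x
    have := norm_integral_le_of_norm_le_const (μ := gam (Fin p)) (f := fun z => g (x + s • z)) (C := L)
      (Filter.Eventually.of_forall fun z => h.gb _)
    simpa using this
  · intro x k
    have e : BLproof.heat s f (x + k) - BLproof.heat s f x - (∫ z, g (x + s • z) ∂(gam (Fin p))) k
      = ∫ z, (f ((x + s • z) + k) - f (x + s • z) - g (x + s • z) k) ∂(gam (Fin p)) := by
      have Igk : Integrable (fun z => g (x + s • z) k) (gam (Fin p)) :=
        (Ig x).apply_continuousLinearMap k
      have If2 : Integrable (fun z => f (x + s • z + k)) (gam (Fin p)) := by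
        have := If (x + k)
        simpa [add_right_comm] using this
      have I12 : Integrable (fun z => f (x + s • z + k) - f (x + s • z)) (gam (Fin p)) := If2.sub (If x)
      rw [integral_sub I12 Igk, integral_sub If2 (If x), ContinuousLinearMap.integral_apply (Ig x)]
      simp only [BLproof.heat, add_right_comm]
    rw [e]
    have := norm_integral_le_of_norm_le_const (μ := gam (Fin p))
      (f := fun z => f ((x + s • z) + k) - f (x + s • z) - g (x + s • z) k) (C := K * ‖k‖ ^ 2)
      (Filter.Eventually.of_forall fun z => h.ta _ _)
    simpa using this

lemma integrable_pow3 (n : ℕ) : Integrable (fun z : Fin n → ℝ => (1 + ‖z‖) ^ 3) (gam (Fin n)) := by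
  have h0 : MemLp (fun z : Fin n → ℝ => ‖z‖) 3 (gam (Fin n)) :=
    (IsGaussian.memLp_id (gam (Fin n)) 3 (by simp)).norm
  have hc : MemLp (fun _ : Fin n → ℝ => (1 : ℝ)) 3 (gam (Fin n)) := memLp_const 1
  have h1 : MemLp (fun z : Fin n → ℝ => 1 + ‖z‖) ((3 : ℕ) : ℝ≥0∞) (gam (Fin n)) := by
    exact_mod_cast hc.add h0
  have := h1.integrable_norm_pow (p := 3) (by norm_num)
  refine this.congr (Filter.Eventually.of_forall fun z => ?_)
  simp only [Real.norm_eq_abs]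
  rw [abs_of_nonneg (by positivity)]

lemma integrable_pow2 (n : ℕ) : Integrable (fun z : Fin n → ℝ => ‖z‖ ^ 2) (gam (Fin n)) := by
  exact (IsGaussian.memLp_id (gam (Fin n)) 2 (by norm_num)).integrable_norm_pow (p := 2) (by norm_num)

lemma integral_comp_V {n p : ℕ} (V : (Fin n → ℝ) →L[ℝ] (Fin p → ℝ))
    (hV : (gam (Fin n)).map V = gam (Fin p)) (f : (Fin p → ℝ) → ℝ) (hf : Continuous f) :
    ∫ z, f (V z) ∂(gam (Fin n)) = ∫ z, f z ∂(gam (Fin p)) := by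
  rw [← hV, integral_map V.continuous.aemeasurable hf.aestronglyMeasurable]

/-- the remainder estimate -/
lemma Reg.remainder {n p : ℕ} {c b L K : ℝ} {f : (Fin p → ℝ) → ℝ}
    {g : (Fin p → ℝ) → StrongDual ℝ (Fin p → ℝ)} (h : Reg c b L K f g) (hc : 0 < c) (hK : 0 ≤ K)
    (V : (Fin n → ℝ) →L[ℝ] (Fin p → ℝ)) (hV : (gam (Fin n)).map V = gam (Fin p))
    {W : ℝ} (hW : ‖V‖ ≤ W) (s : ℝ) (y : Fin p → ℝ) (z : Fin n → ℝ) :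
    |f (y + s • V z) - BLproof.heat s f y - s * g y (V z)|
      ≤ K * W ^ 2 * s ^ 2 * (‖z‖ ^ 2 + ∫ z, ‖z‖ ^ 2 ∂(gam (Fin n))) := by
  have hR : ∀ z, |f (y + s • V z) - f y - s * g y (V z)| ≤ K * W ^ 2 * s ^ 2 * ‖z‖ ^ 2 := by
    intro z
    have h1 := h.ta y (s • V z)
    rw [map_smul, smul_eq_mul] at h1
    refine h1.trans ?_
    rw [norm_smul, mul_pow, Real.norm_eq_abs, sq_abs]
    have h2 : ‖V z‖ ≤ W * ‖z‖ := (V.le_opNorm z).trans (by gcongr)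
    calc K * (s ^ 2 * ‖V z‖ ^ 2) ≤ K * (s ^ 2 * (W * ‖z‖) ^ 2) := by gcongr
      _ = _ := by ring
  have If : Integrable (fun z => f (y + s • V z)) (gam (Fin n)) :=
    integrable_of_bdd (h.cf.comp (by fun_prop)) (fun z => h.abs_le hc _)
  have hl : ∫ z, s * g y (V z) ∂(gam (Fin n)) = 0 := by
    rw [integral_const_mul]
    have := gam_integral_dual ((g y).comp V)
    simp only [ContinuousLinearMap.comp_apply] at this
    rw [this, mul_zero]
  have Il : Integrable (fun z => s * g y (V z)) (gam (Fin n)) :=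
    (IsGaussian.integrable_dual (gam (Fin n)) ((g y).comp V)).const_mul s
  have hh : BLproof.heat s f y - f y = ∫ z, (f (y + s • V z) - f y - s * g y (V z)) ∂(gam (Fin n)) := by
    have I12 : Integrable (fun z => f (y + s • V z) - f y) (gam (Fin n)) := If.sub (integrable_const _)
    rw [integral_sub I12 Il, integral_sub If (integrable_const _), hl]
    rw [integral_comp_V V hV (fun w => f (y + s • w)) (h.cf.comp (by fun_prop))]
    simp [BLproof.heat]
  have hb : |BLproof.heat s f y - f y| ≤ K * W ^ 2 * s ^ 2 * ∫ z, ‖z‖ ^ 2 ∂(gam (Fin n)) := by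
    rw [hh, ← integral_const_mul]
    exact norm_integral_le_of_norm_le (f := fun z => f (y + s • V z) - f y - s * g y (V z))
      ((integrable_pow2 n).const_mul _) (Filter.Eventually.of_forall hR)
  have e : f (y + s • V z) - BLproof.heat s f y - s * g y (V z)
    = (f (y + s • V z) - f y - s * g y (V z)) - (BLproof.heat s f y - f y) := by ring
  rw [e, mul_add]
  exact (abs_sub _ _).trans (add_le_add (hR z) hb)

end BLproof

namespace BLproof

lemma onestep {m n : ℕ} (nn : Fin m → ℕ) (d : Fin m → ℝ) (hd0 : ∀ i, 0 < d i)
    (V : ∀ i, (Fin n → ℝ) →L[ℝ] (Fin (nn i) → ℝ))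
    (hV : ∀ i, (gam (Fin n)).map (V i) = gam (Fin (nn i)))
    (hQ : ∀ l : ∀ i, StrongDual ℝ (Fin (nn i) → ℝ),
      ∑ k, (∑ i, d i * l i (V i (Pi.single k 1))) ^ 2
        ≤ ∑ i, d i * ∑ k, (l i (V i (Pi.single k 1))) ^ 2)
    (c b L K : ℝ) (hc : 0 < c) (hb : 0 ≤ b) (hL : 0 ≤ L) (hK : 0 ≤ K) :
    ∃ K0 : ℝ, 0 ≤ K0 ∧ ∀ s : ℝ, 0 ≤ s → ∀ (f : ∀ i, (Fin (nn i) → ℝ) → ℝ)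
      (g : ∀ i, (Fin (nn i) → ℝ) → StrongDual ℝ (Fin (nn i) → ℝ)),
      (∀ i, Reg c b L K (f i) (g i)) → ∀ x : Fin n → ℝ,
      ∫ z, ∏ i, (f i (V i (x + s • z))) ^ (d i) ∂(gam (Fin n))
        ≤ (1 + K0 * s ^ 3) * ∏ i, (heat s (f i) (V i x)) ^ (d i) := by
  obtain ⟨W, hWdef⟩ : ∃ W, W = ∑ i, ‖V i‖ := ⟨_, rfl⟩
  have hW : ∀ i, ‖V i‖ ≤ W := fun i => by
    rw [hWdef]
    exact Finset.single_le_sum (f := fun i => ‖V i‖) (fun j _ => norm_nonneg _) (Finset.mem_univ i)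
  have hW0 : 0 ≤ W := by rw [hWdef]; positivity
  obtain ⟨M2, hM2⟩ : ∃ M2, M2 = ∫ z, ‖z‖ ^ 2 ∂(gam (Fin n)) := ⟨_, rfl⟩
  obtain ⟨M3, hM3⟩ : ∃ M3, M3 = ∫ z : Fin n → ℝ, (1 + ‖z‖) ^ 3 ∂(gam (Fin n)) := ⟨_, rfl⟩
  have hM20 : 0 ≤ M2 := by rw [hM2]; exact integral_nonneg fun z => by positivity
  have hM30 : 0 ≤ M3 := by rw [hM3]; exact integral_nonneg fun z => by positivity
  obtain ⟨K4, hK4, hpw⟩ := pointwise d hd0 (b / c) (K * W ^ 2 * (1 + M2) / c) (L * W / c)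
    (by positivity) (by positivity) (by positivity)
  refine ⟨K4 * M3, by positivity, ?_⟩
  intro s hs f g hf x
  have hfb : ∀ i, c ≤ heat s (f i) (V i x) := fun i => ((hf i).heat hc s).lo _
  have hfb' : ∀ i, heat s (f i) (V i x) ≤ b := fun i => ((hf i).heat hc s).hi _
  obtain ⟨F, hF⟩ : ∃ F : Fin m → ℝ, ∀ i, F i = heat s (f i) (V i x) := ⟨_, fun _ => rfl⟩
  simp only [← hF] at hfb hfb' ⊢
  have hF0 : ∀ i, 0 < F i := fun i => hc.trans_le (hfb i)
  obtain ⟨ξ, hξ⟩ : ∃ ξ : Fin m → (Fin n → ℝ) → ℝ, ∀ i z, ξ i z = (f i (V i x + s • V i z) - F i) / F i :=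
    ⟨_, fun _ _ => rfl⟩
  obtain ⟨l, hl⟩ : ∃ l : ∀ i, StrongDual ℝ (Fin (nn i) → ℝ), ∀ i, l i = (s / F i) • g i (V i x) :=
    ⟨_, fun _ => rfl⟩
  have hle : ∀ z, ∏ i, (1 + ξ i z) ^ (d i) ≤ 1 + ∑ i, d i * ξ i z
        + ((∑ i, d i * l i (V i z)) ^ 2 - ∑ i, d i * (l i (V i z)) ^ 2) / 2 + K4 * (s * (1 + ‖z‖)) ^ 3 := by
    intro z
    have hz := norm_nonneg z
    refine hpw (s * (1 + ‖z‖)) (by positivity) (fun i => ξ i z) (fun i => l i (V i z)) ?_ ?_ ?_ ?_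
    · intro i
      have h1 : 1 + ξ i z = f i (V i x + s • V i z) / F i := by
        rw [hξ]; have := (hF0 i).ne'; field_simp; ring
      have h2 : 0 < f i (V i x + s • V i z) / F i := div_pos (hc.trans_le ((hf i).lo _)) (hF0 i)
      linarith
    · intro i
      rw [hξ, abs_div, abs_of_pos (hF0 i)]
      apply div_le_div₀ hb _ hc (hfb i)
      rw [abs_le]
      have := (hf i).lo (V i x + s • V i z); have := (hf i).hi (V i x + s • V i z)
      have := hfb i; have := hfb' i
      constructor <;> linarith
    · intro i
      rw [hl, _root_.smul_apply, smul_eq_mul, abs_mul, abs_of_nonneg (div_nonneg hs (hF0 i).le)]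
      have h1 : |g i (V i x) (V i z)| ≤ L * (W * ‖z‖) :=
        ((g i (V i x)).le_opNorm _).trans (mul_le_mul ((hf i).gb _)
          (((V i).le_opNorm z).trans (by gcongr; exact hW i)) (norm_nonneg _) hL)
      calc s / F i * |g i (V i x) (V i z)| ≤ s / c * (L * (W * (1 + ‖z‖))) := by
            gcongr
            · exact hfb i
            · refine h1.trans ?_
              gcongr; linarith
        _ = _ := by ring
    · intro i
      have e : ξ i z - l i (V i z) = (f i (V i x + s • V i z) - F i - s * g i (V i x) (V i z)) / F i := by
        rw [hl, hξ, _root_.smul_apply, smul_eq_mul]; ring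
      rw [e, abs_div, abs_of_pos (hF0 i)]
      have h1 := (hf i).remainder hc hK (V i) (hV i) (hW i) s (V i x) z
      rw [← hF, ← hM2] at h1
      have h2 : K * W ^ 2 * s ^ 2 * (‖z‖ ^ 2 + M2) ≤ K * W ^ 2 * s ^ 2 * ((1 + M2) * (1 + ‖z‖) ^ 2) := by
        gcongr
        nlinarith [mul_nonneg hM20 hz, mul_nonneg hM20 (sq_nonneg ‖z‖)]
      calc _ ≤ (K * W ^ 2 * s ^ 2 * ((1 + M2) * (1 + ‖z‖) ^ 2)) / c :=
            div_le_div₀ (by positivity) (h1.trans h2) hc (hfb i)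
        _ = _ := by ring
  -- integrability
  have If : ∀ i, Integrable (fun z => f i (V i x + s • V i z)) (gam (Fin n)) := fun i =>
    integrable_of_bdd ((hf i).cf.comp (by fun_prop)) (fun z => (hf i).abs_le hc _)
  have Iξ : ∀ i, Integrable (fun z => d i * ξ i z) (gam (Fin n)) := by
    intro i
    have : (fun z => d i * ξ i z) = fun z => d i * ((f i (V i x + s • V i z) - F i) / F i) := by
      ext z; rw [hξ]
    rw [this]
    exact (((If i).sub (integrable_const _)).div_const _).const_mul _
  have hξ0 : ∀ i, ∫ z, d i * ξ i z ∂(gam (Fin n)) = 0 := by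
    intro i
    simp only [hξ]
    rw [integral_const_mul, integral_div, integral_sub (If i) (integrable_const _),
      integral_comp_V (V i) (hV i) (fun w => f i (V i x + s • w)) ((hf i).cf.comp (by fun_prop)), hF]
    simp [heat]
  have Isq : ∀ Λ : StrongDual ℝ (Fin n → ℝ), Integrable (fun z => (Λ z) ^ 2) (gam (Fin n)) :=
    fun Λ => (IsGaussian.memLp_dual (gam (Fin n)) Λ 2 (by simp)).integrable_sq
  have e1 : ∀ z, ∑ i, d i * l i (V i z) = (∑ i, d i • (l i).comp (V i)) z := by
    intro z; simp
  have I1 : Integrable (fun z => (∑ i, d i * l i (V i z)) ^ 2) (gam (Fin n)) := by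
    simp only [e1]; exact Isq _
  have I2 : ∀ i, Integrable (fun z => d i * (l i (V i z)) ^ 2) (gam (Fin n)) := fun i =>
    (Isq ((l i).comp (V i))).const_mul _
  have IS2 : Integrable (fun z => ∑ i, d i * (l i (V i z)) ^ 2) (gam (Fin n)) :=
    integrable_finsetSum _ fun i _ => I2 i
  have v1 : ∫ z, (∑ i, d i * l i (V i z)) ^ 2 ∂(gam (Fin n)) = ∑ k, (∑ i, d i * l i (V i (Pi.single k 1))) ^ 2 := by
    simp only [e1]; exact gam_sq _
  have v2 : ∫ z, ∑ i, d i * (l i (V i z)) ^ 2 ∂(gam (Fin n))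
      = ∑ i, d i * ∑ k, (l i (V i (Pi.single k 1))) ^ 2 := by
    rw [integral_finsetSum _ fun i _ => I2 i]
    refine Finset.sum_congr rfl fun i _ => ?_
    rw [integral_const_mul]
    congr 1
    exact gam_sq ((l i).comp (V i))
  have I3 : Integrable (fun z : Fin n → ℝ => K4 * (s * (1 + ‖z‖)) ^ 3) (gam (Fin n)) := by
    simp only [mul_pow]
    exact ((integrable_pow3 n).const_mul _).const_mul _
  have IS : Integrable (fun z => ∑ i, d i * ξ i z) (gam (Fin n)) := integrable_finsetSum _ fun i _ => Iξ i
  have Ia : Integrable (fun z => 1 + ∑ i, d i * ξ i z) (gam (Fin n)) := (integrable_const _).add IS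
  have Ib : Integrable (fun z => ((∑ i, d i * l i (V i z)) ^ 2 - ∑ i, d i * (l i (V i z)) ^ 2) / 2) (gam (Fin n)) :=
    (I1.sub IS2).div_const 2
  have Iab : Integrable (fun z => 1 + ∑ i, d i * ξ i z +
      ((∑ i, d i * l i (V i z)) ^ 2 - ∑ i, d i * (l i (V i z)) ^ 2) / 2) (gam (Fin n)) := Ia.add Ib
  have hpos : ∀ i z, 0 ≤ 1 + ξ i z := by
    intro i z
    have h1 : 1 + ξ i z = f i (V i x + s • V i z) / F i := by
      rw [hξ]; have := (hF0 i).ne'; field_simp; ring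
    rw [h1]
    exact (div_pos (hc.trans_le ((hf i).lo _)) (hF0 i)).le
  have hint : ∫ z, ∏ i, (1 + ξ i z) ^ (d i) ∂(gam (Fin n)) ≤ 1 + K4 * M3 * s ^ 3 := by
    have h1 := integral_mono_of_nonneg (μ := gam (Fin n))
      (Filter.Eventually.of_forall fun z => Finset.prod_nonneg fun i _ => Real.rpow_nonneg (hpos i z) (d i))
      (Iab.add I3) (Filter.Eventually.of_forall hle)
    refine h1.trans ?_
    rw [integral_add' Iab I3, integral_add Ia Ib, integral_add (integrable_const _) IS, integral_div,
      integral_sub I1 IS2, v1, v2, integral_finsetSum _ fun i _ => Iξ i]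
    simp only [hξ0, mul_pow]
    rw [integral_const_mul, integral_const_mul, ← hM3]
    have := hQ l
    simp only [integral_const, probReal_univ, smul_eq_mul, Finset.sum_const_zero]
    nlinarith
  have efac : ∀ z, ∏ i, (f i (V i (x + s • z))) ^ (d i)
      = (∏ i, (1 + ξ i z) ^ (d i)) * ∏ i, (F i) ^ (d i) := by
    intro z
    rw [← Finset.prod_mul_distrib]
    refine Finset.prod_congr rfl fun i _ => ?_
    rw [← Real.mul_rpow (hpos i z) (hF0 i).le]
    congr 1
    rw [hξ, map_add, map_smul]
    have := (hF0 i).ne'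
    field_simp; ring
  simp only [efac]
  rw [integral_mul_const]
  exact mul_le_mul_of_nonneg_right hint (Finset.prod_nonneg fun i _ => Real.rpow_nonneg (hF0 i).le _)

end BLproof

namespace BLproof

lemma heat_heat {p : ℕ} {a b c : ℝ} (h : a ^ 2 + b ^ 2 = c ^ 2) (F : (Fin p → ℝ) → ℝ)
    (hF : Continuous F) {C : ℝ} (hC : ∀ x, ‖F x‖ ≤ C) (x : Fin p → ℝ) :
    heat a (heat b F) x = heat c F x := by
  have hcx : Continuous fun w => F (x + w) := hF.comp (by fun_prop)
  have h1 : heat c F x = ∫ w, F (x + w) ∂((gam (Fin p)).map (fun x => c • x)) := by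
    rw [integral_map (by fun_prop) hcx.aestronglyMeasurable]; rfl
  rw [h1, ← gam_semi h, integral_map (by fun_prop) hcx.aestronglyMeasurable, integral_prod]
  · simp only [heat, add_assoc]
  · refine Integrable.of_bound (Continuous.aestronglyMeasurable ?_) C (Filter.Eventually.of_forall fun z => hC _)
    exact hcx.comp (by fun_prop)

lemma iter {m n : ℕ} (nn : Fin m → ℕ) (d : Fin m → ℝ) (hd0 : ∀ i, 0 < d i)
    (V : ∀ i, (Fin n → ℝ) →L[ℝ] (Fin (nn i) → ℝ))
    (c b L K : ℝ) (hc : 0 < c) (δ s : ℝ) (hδ : 0 ≤ δ)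
    (hone : ∀ (f : ∀ i, (Fin (nn i) → ℝ) → ℝ)
      (g : ∀ i, (Fin (nn i) → ℝ) → StrongDual ℝ (Fin (nn i) → ℝ)),
      (∀ i, Reg c b L K (f i) (g i)) → ∀ x : Fin n → ℝ,
      ∫ z, ∏ i, (f i (V i (x + s • z))) ^ (d i) ∂(gam (Fin n))
        ≤ (1 + δ) * ∏ i, (heat s (f i) (V i x)) ^ (d i)) (k : ℕ) :
    ∀ (f : ∀ i, (Fin (nn i) → ℝ) → ℝ)
      (g : ∀ i, (Fin (nn i) → ℝ) → StrongDual ℝ (Fin (nn i) → ℝ)),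
      (∀ i, Reg c b L K (f i) (g i)) → ∀ x : Fin n → ℝ,
      heat (√k * s) (fun y => ∏ i, (f i (V i y)) ^ (d i)) x
        ≤ (1 + δ) ^ k * ∏ i, (heat (√k * s) (f i) (V i x)) ^ (d i) := by
  induction k with
  | zero => intro f g hf x; simp [heat]
  | succ k ih =>
    intro f g hf x
    have hsq : (√(k : ℝ) * s) ^ 2 + s ^ 2 = (√((k + 1 : ℕ) : ℝ) * s) ^ 2 := by
      rw [mul_pow, mul_pow, Real.sq_sqrt (by positivity), Real.sq_sqrt (by positivity)]
      push_cast; ring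
    have hGc : ∀ (f : ∀ i, (Fin (nn i) → ℝ) → ℝ)
      (g : ∀ i, (Fin (nn i) → ℝ) → StrongDual ℝ (Fin (nn i) → ℝ)),
      (∀ i, Reg c b L K (f i) (g i)) → Continuous (fun y => ∏ i, (f i (V i y)) ^ (d i)) := by
      intro f g hf
      refine continuous_finsetProd _ fun i _ => ?_
      exact ((hf i).cf.comp (V i).continuous).rpow_const fun x => Or.inr (hd0 i).le
    have hG0 : ∀ (f : ∀ i, (Fin (nn i) → ℝ) → ℝ)
      (g : ∀ i, (Fin (nn i) → ℝ) → StrongDual ℝ (Fin (nn i) → ℝ)),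
      (∀ i, Reg c b L K (f i) (g i)) → ∀ y, 0 ≤ ∏ i, (f i (V i y)) ^ (d i) := by
      intro f g hf y
      exact Finset.prod_nonneg fun i _ => Real.rpow_nonneg (hc.le.trans ((hf i).lo _)) _
    have hGb : ∀ (f : ∀ i, (Fin (nn i) → ℝ) → ℝ)
      (g : ∀ i, (Fin (nn i) → ℝ) → StrongDual ℝ (Fin (nn i) → ℝ)),
      (∀ i, Reg c b L K (f i) (g i)) → ∀ y, ‖∏ i, (f i (V i y)) ^ (d i)‖ ≤ ∏ i, b ^ (d i) := by
      intro f g hf y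
      rw [Real.norm_eq_abs, abs_of_nonneg (hG0 f g hf y)]
      refine Finset.prod_le_prod (fun i _ => Real.rpow_nonneg (hc.le.trans ((hf i).lo _)) _) fun i _ => ?_
      exact Real.rpow_le_rpow (hc.le.trans ((hf i).lo _)) ((hf i).hi _) (hd0 i).le
    have hTf : ∀ i, Reg c b L K (heat s (f i)) _ := fun i => (hf i).heat hc s
    rw [← heat_heat hsq _ (hGc f g hf) (hGb f g hf)]
    have hstep : heat (√(k : ℝ) * s) (heat s (fun y => ∏ i, (f i (V i y)) ^ (d i))) x
        ≤ (1 + δ) * heat (√(k : ℝ) * s) (fun y => ∏ i, (heat s (f i) (V i y)) ^ (d i)) x := by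
      simp only [heat]
      rw [← integral_const_mul]
      refine integral_mono_of_nonneg (Filter.Eventually.of_forall fun z => ?_) ?_
        (Filter.Eventually.of_forall fun z => ?_)
      · exact integral_nonneg fun z => hG0 f g hf _
      · refine Integrable.const_mul ?_ _
        exact integrable_of_bdd ((hGc _ _ hTf).comp (by fun_prop)) (fun z => hGb _ _ hTf _)
      · exact hone f g hf _
    refine hstep.trans ?_
    have h2 := ih _ _ hTf x
    have h3 : ∀ i, heat (√(k : ℝ) * s) (heat s (f i)) (V i x) = heat (√((k + 1 : ℕ) : ℝ) * s) (f i) (V i x) :=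
      fun i => heat_heat hsq _ (hf i).cf (fun x => (hf i).abs_le hc x) _
    simp only [h3] at h2
    rw [pow_succ', mul_assoc]
    exact mul_le_mul_of_nonneg_left h2 (by linarith)

lemma smooth_case {m n : ℕ} (nn : Fin m → ℕ) (d : Fin m → ℝ) (hd0 : ∀ i, 0 < d i)
    (V : ∀ i, (Fin n → ℝ) →L[ℝ] (Fin (nn i) → ℝ))
    (hV : ∀ i, (gam (Fin n)).map (V i) = gam (Fin (nn i)))
    (hQ : ∀ l : ∀ i, StrongDual ℝ (Fin (nn i) → ℝ),
      ∑ k, (∑ i, d i * l i (V i (Pi.single k 1))) ^ 2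
        ≤ ∑ i, d i * ∑ k, (l i (V i (Pi.single k 1))) ^ 2)
    (c b L K : ℝ) (hc : 0 < c) (hb : 0 ≤ b) (hL : 0 ≤ L) (hK : 0 ≤ K)
    (f : ∀ i, (Fin (nn i) → ℝ) → ℝ)
    (g : ∀ i, (Fin (nn i) → ℝ) → StrongDual ℝ (Fin (nn i) → ℝ))
    (hf : ∀ i, Reg c b L K (f i) (g i)) :
    ∫ z, ∏ i, (f i (V i z)) ^ (d i) ∂(gam (Fin n)) ≤ ∏ i, (∫ z, f i z ∂(gam (Fin (nn i)))) ^ (d i) := by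
  obtain ⟨K0, hK0, hone⟩ := onestep nn d hd0 V hV hQ c b L K hc hb hL hK
  set P := ∏ i, (∫ z, f i z ∂(gam (Fin (nn i)))) ^ (d i) with hP
  have hP0 : 0 ≤ P := by
    refine Finset.prod_nonneg fun i _ => Real.rpow_nonneg ?_ _
    exact integral_nonneg fun z => hc.le.trans ((hf i).lo z)
  have hN : ∀ N : ℕ, ∫ z, ∏ i, (f i (V i z)) ^ (d i) ∂(gam (Fin n))
      ≤ Real.exp (K0 * (√((N + 1 : ℕ) : ℝ))⁻¹) * P := by
    intro N
    have hpos : 0 < √((N + 1 : ℕ) : ℝ) := by positivity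
    set r := √((N + 1 : ℕ) : ℝ) with hr
    have hr2 : r ^ 2 = ((N + 1 : ℕ) : ℝ) := Real.sq_sqrt (by positivity)
    have h1 := iter nn d hd0 V c b L K hc (K0 * (r⁻¹) ^ 3) r⁻¹ (by positivity)
      (fun f g hf x => hone r⁻¹ (by positivity) f g hf x) (N + 1) f g hf 0
    rw [← hr, mul_inv_cancel₀ hpos.ne'] at h1
    simp only [heat, one_smul, zero_add, map_zero] at h1
    refine h1.trans ?_
    gcongr
    calc (1 + K0 * (r⁻¹) ^ 3) ^ (N + 1) ≤ (Real.exp (K0 * (r⁻¹) ^ 3)) ^ (N + 1) := by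
          gcongr
          rw [add_comm]; exact Real.add_one_le_exp _
      _ = Real.exp (K0 * r⁻¹) := by
          rw [← Real.exp_nat_mul, ← hr2]
          congr 1
          field_simp
  have hlim : Filter.Tendsto (fun N : ℕ => Real.exp (K0 * (√((N + 1 : ℕ) : ℝ))⁻¹) * P) Filter.atTop
      (nhds (Real.exp (K0 * 0) * P)) := by
    refine Filter.Tendsto.mul_const _ ?_
    refine (Real.continuous_exp.tendsto _).comp ?_
    refine Filter.Tendsto.const_mul _ ?_
    refine Filter.Tendsto.inv_tendsto_atTop ?_
    exact Real.tendsto_sqrt_atTop.comp (tendsto_natCast_atTop_atTop.comp (Filter.tendsto_add_atTop_nat 1))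
  have := ge_of_tendsto' hlim hN
  simpa using this

end BLproof

namespace BLproof

open Filter Topology
open scoped ContDiff

lemma Reg.mono {p : ℕ} {c b L K b' L' K' : ℝ} {f : (Fin p → ℝ) → ℝ}
    {g : (Fin p → ℝ) → StrongDual ℝ (Fin p → ℝ)} (h : Reg c b L K f g)
    (hb : b ≤ b') (hL : L ≤ L') (hK : K ≤ K') : Reg c b' L' K' f g where
  cf := h.cf
  cg := h.cg
  lo := h.lo
  hi := fun x => (h.hi x).trans hb
  gb := fun x => (h.gb x).trans hL
  ta := fun x y => (h.ta x y).trans (by gcongr)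

lemma reg_of_smooth {p : ℕ} (φ : (Fin p → ℝ) → ℝ) (hφ : ContDiff ℝ ∞ φ)
    (hs : HasCompactSupport φ) (c : ℝ) :
    ∃ b L K : ℝ, 0 ≤ b ∧ 0 ≤ L ∧ 0 ≤ K ∧
      Reg c b L K (fun x => φ x ^ 2 + c) (fderiv ℝ (fun x => φ x ^ 2)) := by
  set ψ : (Fin p → ℝ) → ℝ := fun x => φ x ^ 2 with hψ
  have hψc : ContDiff ℝ ∞ ψ := hφ.pow 2
  have hψs : HasCompactSupport ψ := by
    refine hs.comp_left (g := fun t : ℝ => t ^ 2) ?_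
    simp
  have hdc : ContDiff ℝ 1 (fderiv ℝ ψ) := hψc.fderiv_right (by norm_cast)
  have hds : HasCompactSupport (fderiv ℝ ψ) := hψs.fderiv ℝ
  obtain ⟨C, hC⟩ := hdc.lipschitzWith_of_hasCompactSupport hds (by norm_num)
  obtain ⟨b, hb⟩ := hψs.exists_bound_of_continuous hψc.continuous
  obtain ⟨L, hL⟩ := hds.exists_bound_of_continuous hdc.continuous
  refine ⟨|b + c|, |L|, C, abs_nonneg _, abs_nonneg _, C.2, ?_⟩
  have hdiff : Differentiable ℝ ψ := hψc.differentiable (by norm_num)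
  refine ⟨by fun_prop, hdc.continuous, fun x => ?_, fun x => ?_, fun x => (hL x).trans (le_abs_self _), ?_⟩
  · have := sq_nonneg (φ x); linarith
  · have := (le_abs_self _).trans (hb x)
    refine le_trans ?_ (le_abs_self _)
    simp only [hψ] at this
    linarith
  · intro x h
    have key := (convex_closedBall x ‖h‖).norm_image_sub_le_of_norm_hasFDerivWithin_le'
      (f := ψ) (f' := fderiv ℝ ψ) (φ := fderiv ℝ ψ x) (C := C * ‖h‖) (x := x) (y := x + h)
      (fun y _ => (hdiff y).hasFDerivAt.hasFDerivWithinAt)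
      (fun y hy => by
        have := hC.norm_sub_le y x
        refine this.trans ?_
        have hy' : ‖y - x‖ ≤ ‖h‖ := by simpa [dist_eq_norm] using hy
        gcongr) (by simp) (by simp)
    simp only [add_sub_cancel_left, Real.norm_eq_abs] at key
    have e : φ (x + h) ^ 2 + c - (φ x ^ 2 + c) - fderiv ℝ ψ x h = ψ (x + h) - ψ x - fderiv ℝ ψ x h := by
      simp only [hψ]; ring
    simp only [e]
    refine key.trans (le_of_eq ?_)
    ring

lemma lint_sq {p : ℕ} (φ : (Fin p → ℝ) → ℝ) :
    ∫⁻ x, ENNReal.ofReal (φ x ^ 2) ∂(gam (Fin p)) = (eLpNorm φ 2 (gam (Fin p))) ^ 2 := by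
  have h := eLpNorm_nnreal_pow_eq_lintegral (μ := gam (Fin p)) (f := φ) (p := 2) (by norm_num)
  have e : (eLpNorm φ 2 (gam (Fin p))) ^ 2 = eLpNorm φ ((2 : NNReal) : ℝ≥0∞) (gam (Fin p)) ^ ((2 : NNReal) : ℝ) := by
    norm_num
  rw [e, h]
  refine lintegral_congr fun x => ?_
  rw [← ofReal_norm_eq_enorm, ENNReal.ofReal_rpow_of_nonneg (norm_nonneg _) (by norm_num)]
  norm_num

lemma approx {p : ℕ} (h : (Fin p → ℝ) → ℝ) (hm : Measurable h) (h0 : ∀ x, 0 ≤ h x)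
    (hfin : ∫⁻ x, ENNReal.ofReal (h x) ∂(gam (Fin p)) ≠ ⊤) :
    ∃ (F : ℕ → (Fin p → ℝ) → ℝ) (G : ℕ → (Fin p → ℝ) → StrongDual ℝ (Fin p → ℝ)) (a : ℕ → ℝ≥0∞),
      (∀ k : ℕ, ∃ b L K : ℝ, 0 ≤ b ∧ 0 ≤ L ∧ 0 ≤ K ∧
        Reg (1 / ((k : ℝ) + 1)) b L K (F k) (G k)) ∧
      (∀ k, ∫⁻ x, ENNReal.ofReal (F k x) ∂(gam (Fin p)) ≤ a k) ∧
      Tendsto a atTop (𝓝 (∫⁻ x, ENNReal.ofReal (h x) ∂(gam (Fin p)))) ∧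
      ∀ᵐ x ∂(gam (Fin p)), Tendsto (fun k => F k x) atTop (𝓝 (h x)) := by
  set u : (Fin p → ℝ) → ℝ := fun x => √(h x) with hu
  have hum : Measurable u := hm.sqrt
  have hu2 : ∀ x, u x ^ 2 = h x := fun x => Real.sq_sqrt (h0 x)
  have hN : (eLpNorm u 2 (gam (Fin p))) ^ 2 = ∫⁻ x, ENNReal.ofReal (h x) ∂(gam (Fin p)) := by
    rw [← lint_sq]; simp only [hu2]
  have hNt : eLpNorm u 2 (gam (Fin p)) ≠ ⊤ := by
    intro e; rw [e] at hN; apply hfin; rw [← hN]; simp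
  have hmem : MemLp u 2 (gam (Fin p)) := ⟨hum.aestronglyMeasurable, lt_top_iff_ne_top.2 hNt⟩
  have hex : ∀ k : ℕ, ∃ g : (Fin p → ℝ) → ℝ, HasCompactSupport g ∧ ContDiff ℝ ∞ g ∧
      eLpNorm (u - g) 2 (gam (Fin p)) ≤ ENNReal.ofReal (1 / ((k : ℝ) + 1)) := fun k =>
    hmem.exist_eLpNorm_sub_le (by norm_num) (by norm_num) (by positivity)
  choose φ hφs hφc hφe using hex
  have hε : Tendsto (fun k : ℕ => ENNReal.ofReal (1 / ((k : ℝ) + 1))) atTop (𝓝 0) := by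
    have := ENNReal.tendsto_ofReal (tendsto_one_div_add_atTop_nhds_zero_nat (𝕜 := ℝ))
    simpa using this
  have hφe' : ∀ k, eLpNorm (φ k - u) 2 (gam (Fin p)) ≤ ENNReal.ofReal (1 / ((k : ℝ) + 1)) := by
    intro k; rw [eLpNorm_sub_comm]; exact hφe k
  have hmeasφ : ∀ k, AEStronglyMeasurable (φ k) (gam (Fin p)) := fun k =>
    (hφc k).continuous.aestronglyMeasurable
  have hTm : TendstoInMeasure (gam (Fin p)) φ atTop u := by
    refine tendstoInMeasure_of_tendsto_eLpNorm (p := 2) (by norm_num) hmeasφ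
      hum.aestronglyMeasurable ?_
    exact tendsto_of_tendsto_of_tendsto_of_le_of_le tendsto_const_nhds hε (fun _ => zero_le) hφe'
  obtain ⟨ns, hns, hae⟩ := hTm.exists_seq_tendsto_ae
  refine ⟨fun k x => φ (ns k) x ^ 2 + 1 / ((k : ℝ) + 1), fun k => fderiv ℝ (fun x => φ (ns k) x ^ 2),
    fun k => (eLpNorm u 2 (gam (Fin p)) + ENNReal.ofReal (1 / ((ns k : ℝ) + 1))) ^ 2
      + ENNReal.ofReal (1 / ((k : ℝ) + 1)), fun k => reg_of_smooth _ (hφc _) (hφs _) _, fun k => ?_, ?_, ?_⟩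
  · have : ∀ x, ENNReal.ofReal (φ (ns k) x ^ 2 + 1 / ((k : ℝ) + 1))
        = ENNReal.ofReal (φ (ns k) x ^ 2) + ENNReal.ofReal (1 / ((k : ℝ) + 1)) := fun x =>
      ENNReal.ofReal_add (by positivity) (by positivity)
    simp only [this]
    rw [lintegral_add_right _ measurable_const, lint_sq, lintegral_const, measure_univ, mul_one]
    gcongr
    have e : φ (ns k) = u + (φ (ns k) - u) := by simp
    calc eLpNorm (φ (ns k)) 2 (gam (Fin p)) = eLpNorm (u + (φ (ns k) - u)) 2 (gam (Fin p)) := by rw [← e]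
      _ ≤ eLpNorm u 2 (gam (Fin p)) + eLpNorm (φ (ns k) - u) 2 (gam (Fin p)) :=
          eLpNorm_add_le hum.aestronglyMeasurable ((hmeasφ _).sub hum.aestronglyMeasurable) (by norm_num)
      _ ≤ _ := by gcongr; exact hφe' _
  · rw [← hN]
    have h1 : Tendsto (fun k => eLpNorm u 2 (gam (Fin p)) + ENNReal.ofReal (1 / ((ns k : ℝ) + 1))) atTop
        (𝓝 (eLpNorm u 2 (gam (Fin p)) + 0)) :=
      tendsto_const_nhds.add (hε.comp hns.tendsto_atTop)
    have h2 := (((ENNReal.continuous_pow 2).tendsto _).comp h1).add hε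
    simpa [Function.comp_def] using h2
  · filter_upwards [hae] with x hx
    have := (hx.pow 2).add (tendsto_one_div_add_atTop_nhds_zero_nat (𝕜 := ℝ))
    rw [hu2, add_zero] at this
    exact this

lemma general_case {m n : ℕ} (nn : Fin m → ℕ) (d : Fin m → ℝ) (hd0 : ∀ i, 0 < d i)
    (V : ∀ i, (Fin n → ℝ) →L[ℝ] (Fin (nn i) → ℝ))
    (hV : ∀ i, (gam (Fin n)).map (V i) = gam (Fin (nn i)))
    (hQ : ∀ l : ∀ i, StrongDual ℝ (Fin (nn i) → ℝ),
      ∑ k, (∑ i, d i * l i (V i (Pi.single k 1))) ^ 2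
        ≤ ∑ i, d i * ∑ k, (l i (V i (Pi.single k 1))) ^ 2)
    (h : ∀ i, (Fin (nn i) → ℝ) → ℝ) (hm : ∀ i, Measurable (h i)) (h0 : ∀ i x, 0 ≤ h i x) :
    ∫⁻ z, ∏ i, ENNReal.ofReal (h i (V i z)) ^ (d i) ∂(gam (Fin n))
      ≤ ∏ i, (∫⁻ z, ENNReal.ofReal (h i z) ∂(gam (Fin (nn i)))) ^ (d i) := by
  have hae : ∀ i (P : (Fin (nn i) → ℝ) → Prop), (∀ᵐ x ∂(gam (Fin (nn i))), P x) →
      ∀ᵐ z ∂(gam (Fin n)), P (V i z) := by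
    intro i P hP
    rw [← hV i] at hP
    exact ae_of_ae_map (V i).continuous.measurable.aemeasurable hP
  by_cases hz : ∃ i, ∫⁻ z, ENNReal.ofReal (h i z) ∂(gam (Fin (nn i))) = 0
  · obtain ⟨i, hi⟩ := hz
    rw [lintegral_eq_zero_iff (hm i).ennreal_ofReal] at hi
    have h1 := hae i _ hi
    refine le_of_eq_of_le ?_ zero_le
    rw [lintegral_congr_ae (g := fun _ => 0), lintegral_zero]
    filter_upwards [h1] with z hzz
    refine Finset.prod_eq_zero (Finset.mem_univ i) ?_
    rw [hzz]
    simp [hd0 i]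
  push Not at hz
  by_cases ht : ∃ i, ∫⁻ z, ENNReal.ofReal (h i z) ∂(gam (Fin (nn i))) = ⊤
  · obtain ⟨i, hi⟩ := ht
    refine le_of_le_of_eq le_top (Eq.symm ?_)
    rw [← Finset.mul_prod_erase _ _ (Finset.mem_univ i), hi, ENNReal.top_rpow_of_pos (hd0 i)]
    refine ENNReal.top_mul ?_
    refine Finset.prod_ne_zero_iff.2 fun j _ => ?_
    intro e
    rcases ENNReal.rpow_eq_zero_iff.1 e with h' | h'
    · exact hz j h'.1
    · exact absurd h'.2 (hd0 j).le.not_gt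
  push Not at ht
  have hA := fun i => approx (h i) (hm i) (h0 i) (ht i)
  choose F G a hR ha hat hFt using hA
  choose b L K hb hL hK hReg using hR
  have hc : ∀ k : ℕ, (0 : ℝ) < 1 / ((k : ℝ) + 1) := fun k => by positivity
  have hF0 : ∀ i k x, 0 ≤ F i k x := fun i k x => (hc k).le.trans ((hReg i k).lo x)
  have hstep : ∀ k, ∫⁻ z, ∏ i, ENNReal.ofReal (F i k (V i z)) ^ (d i) ∂(gam (Fin n))
      ≤ ∏ i, (a i k) ^ (d i) := by
    intro k
    have hle : ∀ (B : Fin m → ℝ), (∀ i, 0 ≤ B i) → ∀ i, B i ≤ ∑ j, B j := fun B hB i =>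
      Finset.single_le_sum (fun j _ => hB j) (Finset.mem_univ i)
    have hreg : ∀ i, Reg (1 / ((k : ℝ) + 1)) (∑ j, b j k) (∑ j, L j k) (∑ j, K j k) (F i k) (G i k) :=
      fun i => (hReg i k).mono (hle (fun j => b j k) (fun j => hb j k) i)
        (hle (fun j => L j k) (fun j => hL j k) i) (hle (fun j => K j k) (fun j => hK j k) i)
    have hsm := smooth_case nn d hd0 V hV hQ _ _ _ _ (hc k) (Finset.sum_nonneg fun j _ => hb j k)
      (Finset.sum_nonneg fun j _ => hL j k) (Finset.sum_nonneg fun j _ => hK j k)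
      (fun i => F i k) (fun i => G i k) hreg
    have hcont : Continuous fun z => ∏ i, (F i k (V i z)) ^ (d i) := by
      refine continuous_finsetProd _ fun i _ => ?_
      exact ((hReg i k).cf.comp (V i).continuous).rpow_const fun _ => Or.inr (hd0 i).le
    have hnon : ∀ z, 0 ≤ ∏ i, (F i k (V i z)) ^ (d i) := fun z =>
      Finset.prod_nonneg fun i _ => Real.rpow_nonneg (hF0 _ _ _) _
    have hint : Integrable (fun z => ∏ i, (F i k (V i z)) ^ (d i)) (gam (Fin n)) := by
      refine integrable_of_bdd hcont (C := ∏ i, (b i k) ^ (d i)) fun z => ?_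
      rw [Real.norm_eq_abs, abs_of_nonneg (hnon z)]
      refine Finset.prod_le_prod (fun i _ => Real.rpow_nonneg (hF0 _ _ _) _) fun i _ => ?_
      exact Real.rpow_le_rpow (hF0 _ _ _) ((hReg i k).hi _) (hd0 i).le
    have e1 : ∀ z, ∏ i, ENNReal.ofReal (F i k (V i z)) ^ (d i)
        = ENNReal.ofReal (∏ i, (F i k (V i z)) ^ (d i)) := by
      intro z
      rw [ENNReal.ofReal_prod_of_nonneg fun i _ => Real.rpow_nonneg (hF0 _ _ _) _]
      refine Finset.prod_congr rfl fun i _ => ?_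
      rw [ENNReal.ofReal_rpow_of_nonneg (hF0 _ _ _) (hd0 i).le]
    simp only [e1]
    rw [← ofReal_integral_eq_lintegral_ofReal hint (Eventually.of_forall hnon)]
    refine (ENNReal.ofReal_le_ofReal hsm).trans ?_
    have hI0 : ∀ i, 0 ≤ ∫ z, F i k z ∂(gam (Fin (nn i))) := fun i => integral_nonneg fun z => hF0 _ _ _
    rw [ENNReal.ofReal_prod_of_nonneg fun i _ => Real.rpow_nonneg (hI0 i) _]
    refine Finset.prod_le_prod' fun i _ => ?_
    rw [← ENNReal.ofReal_rpow_of_nonneg (hI0 i) (hd0 i).le]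
    refine ENNReal.rpow_le_rpow ?_ (hd0 i).le
    rw [ofReal_integral_eq_lintegral_ofReal _ (Eventually.of_forall (hF0 i k))]
    · exact ha i k
    · exact integrable_of_bdd (hReg i k).cf fun x => (by
        rw [Real.norm_eq_abs, abs_of_nonneg (hF0 i k x)]; exact (hReg i k).hi x)
  have hlimR : Tendsto (fun k => ∏ i, (a i k) ^ (d i)) atTop
      (𝓝 (∏ i, (∫⁻ z, ENNReal.ofReal (h i z) ∂(gam (Fin (nn i)))) ^ (d i))) := by
    refine ENNReal.tendsto_finset_prod_of_ne_top _ (fun i _ => ?_) fun i _ => ?_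
    · exact (ENNReal.continuous_rpow_const.tendsto _).comp (hat i)
    · exact ENNReal.rpow_ne_top_of_nonneg (hd0 i).le (ht i)
  have hall : ∀ᵐ z ∂(gam (Fin n)), ∀ i, Tendsto (fun k => F i k (V i z)) atTop (𝓝 (h i (V i z))) :=
    ae_all_iff.2 fun i => hae i _ (hFt i)
  have hpt : ∀ᵐ z ∂(gam (Fin n)), ∏ i, ENNReal.ofReal (h i (V i z)) ^ (d i)
      = liminf (fun k => ∏ i, ENNReal.ofReal (F i k (V i z)) ^ (d i)) atTop := by
    filter_upwards [hall] with z hzz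
    refine (Tendsto.liminf_eq ?_).symm
    refine ENNReal.tendsto_finset_prod_of_ne_top _ (fun i _ => ?_) fun i _ => ?_
    · exact (ENNReal.continuous_rpow_const.tendsto _).comp (ENNReal.tendsto_ofReal (hzz i))
    · exact ENNReal.rpow_ne_top_of_nonneg (hd0 i).le ENNReal.ofReal_ne_top
  rw [lintegral_congr_ae hpt]
  refine (lintegral_liminf_le fun k => ?_).trans ?_
  · refine Finset.measurable_prod _ fun i _ => ?_
    exact (((hReg i k).cf.comp (V i).continuous).measurable.ennreal_ofReal).pow_const _
  · rw [← hlimR.liminf_eq]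
    exact liminf_le_liminf (Eventually.of_forall hstep)

end BLproof

/-- **Theorem (Ornstein-Uhlenbeck form), upper bound**: if `U Uᵀ ≤ D⁻¹` then
`∫ ∏ fᵢ(Uᵢ x) dγₙ ≤ ∏ (∫ fᵢ^{1/dᵢ} dγ_{nᵢ})^{dᵢ}`. -/
theorem stmt4
    (m n : ℕ) (hmn : n ≤ m) (hn : 0 < n)
    (nn : Fin m → ℕ) (hnn : ∀ i, 0 < nn i) (hnnle : ∀ i, nn i ≤ n)
    (d : Fin m → ℝ) (hd : ∀ i, d i ≠ 0)
    (U : ∀ i, Matrix (Fin (nn i)) (Fin n) ℝ)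
    (hU : ∀ i, U i * (U i)ᵀ = 1)
    (bigU : Matrix (Σ i : Fin m, Fin (nn i)) (Fin n) ℝ)
    (hbigU : ∀ a k, bigU a k = U a.1 a.2 k)
    (hUD : ((Matrix.diagonal fun a : Σ i : Fin m, Fin (nn i) => (d a.1)⁻¹)
        - bigU * bigUᵀ).PosSemidef)
    (f : ∀ i, (Fin (nn i) → ℝ) → ℝ)
    (hmeas : ∀ i, Measurable (f i)) (hpos : ∀ i x, 0 ≤ f i x) :
    ∫⁻ x, ∏ i, ENNReal.ofReal (f i ((U i).mulVec x)) ∂(stdGaussian (Fin n))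
      ≤ ∏ i, (∫⁻ z, ENNReal.ofReal (f i z) ^ (1 / d i)
          ∂(stdGaussian (Fin (nn i)))) ^ (d i) := by
  have hd0 : ∀ i, 0 < d i := by
    intro i
    have h := hUD.diag_nonneg (i := (⟨i, ⟨0, hnn i⟩⟩ : Σ i : Fin m, Fin (nn i)))
    have h1 : (bigU * bigUᵀ) ⟨i, ⟨0, hnn i⟩⟩ ⟨i, ⟨0, hnn i⟩⟩ = 1 := by
      have := congrFun (congrFun (hU i) ⟨0, hnn i⟩) ⟨0, hnn i⟩
      simp only [Matrix.mul_apply, Matrix.transpose_apply, Matrix.one_apply_eq] at this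
      simpa only [Matrix.mul_apply, Matrix.transpose_apply, hbigU] using this
    rw [Matrix.sub_apply, h1, Matrix.diagonal_apply_eq] at h
    have : 0 < (d i)⁻¹ := by linarith
    exact inv_pos.1 this
  let V : ∀ i, (Fin n → ℝ) →L[ℝ] (Fin (nn i) → ℝ) := fun i =>
    LinearMap.toContinuousLinearMap (U i).mulVecLin
  have hVapp : ∀ i x, V i x = (U i).mulVec x := fun i x => rfl
  have hV : ∀ i, (BLproof.gam (Fin n)).map (V i) = BLproof.gam (Fin (nn i)) := fun i =>
    BLproof.gam_map (U i) (hU i)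
  have hQ : ∀ l : ∀ i, StrongDual ℝ (Fin (nn i) → ℝ),
      ∑ k, (∑ i, d i * l i (V i (Pi.single k 1))) ^ 2
        ≤ ∑ i, d i * ∑ k, (l i (V i (Pi.single k 1))) ^ 2 := by
    intro l
    set w : ∀ i, Fin (nn i) → ℝ := fun i j => l i (Pi.single j 1) with hw
    have h1 : ∀ i k, l i (V i (Pi.single k 1)) = ∑ j, w i j * U i j k := by
      intro i k; rw [hVapp, BLproof.dual_eq (l i)]; simp [hw]
    have h2 : ∀ i, ∑ k, (l i (V i (Pi.single k 1))) ^ 2 = ∑ j, w i j ^ 2 := by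
      intro i
      simp only [h1]
      have h2 : ∑ k, (∑ j, w i j * U i j k)^2 = (w i ᵥ* U i) ⬝ᵥ (w i ᵥ* U i) := by
        simp [dotProduct, Matrix.vecMul, sq]
      have h3 : ∑ j, w i j ^ 2 = w i ⬝ᵥ w i := by simp [dotProduct, sq]
      rw [h2, h3, ← Matrix.dotProduct_mulVec]
      rw [← Matrix.mulVec_transpose, Matrix.mulVec_mulVec, hU, Matrix.one_mulVec]
    simp only [h2]
    set v : (Σ i : Fin m, Fin (nn i)) → ℝ := fun a => d a.1 * w a.1 a.2 with hv
    have hp := hUD.dotProduct_mulVec_nonneg v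
    rw [Matrix.sub_mulVec, dotProduct_sub, ← Matrix.mulVec_mulVec, star_trivial,
      Matrix.dotProduct_mulVec v bigU, Matrix.mulVec_transpose] at hp
    have e1 : v ⬝ᵥ (Matrix.diagonal fun a : Σ i : Fin m, Fin (nn i) => (d a.1)⁻¹) *ᵥ v
        = ∑ i, d i * ∑ j, w i j ^ 2 := by
      simp only [dotProduct, Matrix.mulVec_diagonal]
      rw [Fintype.sum_sigma]
      refine Finset.sum_congr rfl fun i _ => ?_
      rw [Finset.mul_sum]
      refine Finset.sum_congr rfl fun j _ => ?_
      simp only [hv]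
      have := hd i
      field_simp
    have e2 : (v ᵥ* bigU) ⬝ᵥ (v ᵥ* bigU) = ∑ k, (∑ i, d i * l i (V i (Pi.single k 1))) ^ 2 := by
      simp only [dotProduct, Matrix.vecMul, ← sq]
      refine Finset.sum_congr rfl fun k _ => ?_
      congr 1
      rw [Fintype.sum_sigma]
      refine Finset.sum_congr rfl fun i _ => ?_
      rw [h1, Finset.mul_sum]
      refine Finset.sum_congr rfl fun j _ => ?_
      simp only [hv, hbigU]
      ring
    rw [e1, e2] at hp
    linarith
  have key := BLproof.general_case nn d hd0 V hV hQ (fun i x => f i x ^ (1 / d i))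
    (fun i => (hmeas i).pow_const _) (fun i x => Real.rpow_nonneg (hpos i x) _)
  have e1 : ∀ i x, ENNReal.ofReal (f i x ^ (1 / d i)) = ENNReal.ofReal (f i x) ^ (1 / d i) := fun i x =>
    (ENNReal.ofReal_rpow_of_nonneg (hpos i x) (one_div_pos.2 (hd0 i)).le).symm
  have e2 : ∀ i x, (ENNReal.ofReal (f i x) ^ (1 / d i)) ^ (d i) = ENNReal.ofReal (f i x) := by
    intro i x
    rw [← ENNReal.rpow_mul, one_div_mul_cancel (hd i), ENNReal.rpow_one]
  simp only [e1, e2] at key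
  exact key
end
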